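/- arXiv:2307.12829 — 2 statements merged into one kernel-verified Lean document; each statement's English description precedes it below -/
import Mathlib

section
/- There exists a constant Q such that for every power of two q = 2^e with q ≥ Q and every finite field F with q^6 elements, there is a subset S ⊆ 𝔠 × {1,5} such that the codes D_{c,s} for (c,s) ∈ S are pairwise inequivalent and 6·e·|S| ≥ |𝔠| (that is, the number of equivalence classes of the codes D_{c,s} is at least |𝔠|/(6e)). -/
noncomputable section

def F1 (q : ℕ) {F : Type*} [Field F] (c : F) : F :=
  c ^ (q ^ 4 + 2 * q ^ 3 + q ^ 2 + q + 1) + c ^ (q ^ 4 + q ^ 3 + q ^ 2 + 1)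
    + c ^ (q ^ 3 + q + 1) + c + c ^ (2 * q ^ 3 + q ^ 2 + q) + c ^ (q ^ 3 + q ^ 2 + q)
    + c ^ (q ^ 3) + 1

def F2 (q : ℕ) {F : Type*} [Field F] (c : F) : F :=
  c ^ (q ^ 3 + q ^ 2 + 2 * q + 2) + c ^ (q ^ 2 + q + 2) + c ^ (q ^ 3 + 2 * q ^ 2 + 2 * q + 1)
    + c ^ (2 * q ^ 3 + 2 * q ^ 2 + q + 1) + c ^ (q ^ 2 + q + 1) + c ^ (q ^ 3 + q + 1)
    + c ^ (q ^ 3 + q ^ 2 + 1) + c + c ^ (2 * q ^ 3 + q ^ 2 + q) + c ^ (q ^ 3 + q ^ 2 + q)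
    + c ^ (q ^ 3) + 1

def F3 (q : ℕ) {F : Type*} [Field F] (c : F) : F := c ^ (q ^ 2 + q + 1) + 1

def F4 (q : ℕ) {F : Type*} [Field F] (c : F) : F :=
  c ^ (2 * q ^ 2 + q + 4) + c ^ (3 * q ^ 2 + 2 * q + 3) + c ^ (q ^ 2 + 2 * q + 3)
    + c ^ (3 * q ^ 2 + q + 3) + c ^ (q ^ 2 + q + 3) + c ^ (2 * q ^ 2 + 3) + c ^ (q ^ 2 + 3)
    + c ^ (4 * q ^ 2 + q + 2) + c ^ (q + 2) + c ^ (3 * q ^ 2 + 2) + c ^ 2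
    + c ^ (3 * q ^ 2 + 2 * q + 1) + c ^ (q ^ 2 + 2 * q + 1) + c ^ (3 * q ^ 2 + q + 1)
    + c ^ (q ^ 2 + q + 1) + c ^ (3 * q ^ 2 + 1) + c + c ^ (2 * q ^ 2 + q) + c ^ (2 * q ^ 2)
    + c ^ (q ^ 2)

def F5 (q : ℕ) {F : Type*} [Field F] (c : F) : F :=
  c ^ (2 * q ^ 2 + q + 2) + c ^ (q ^ 2 + q + 2) + c ^ (2 * q ^ 2 + 2)
    + c ^ (2 * q ^ 2 + q + 1) + c ^ (q ^ 2 + q + 1) + 1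

def frakC (q : ℕ) (F : Type*) [Field F] : Set F :=
  {c | c ^ (q ^ 2) ≠ c ∧ F1 q c = 0 ∧ F2 q c = 0 ∧ F3 q c * F4 q c * F5 q c ≠ 0}

def IsScattered (q : ℕ) {F : Type*} [Field F] (f : F → F) : Prop :=
  ∀ y z : F, y ≠ 0 → z ≠ 0 → f y * z = f z * y → ∃ l : F, l ^ q = l ∧ y = l * z

def Dcode (q : ℕ) {F : Type*} [Field F] (c : F) (s : ℕ) : Set (F → F) :=
  {g | ∃ a b : F,
    g = fun x => a * x + b * (x ^ (q ^ s) + x ^ (q ^ (3 * s)) + c * x ^ (q ^ (5 * s)))}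

def CodeEquiv (q : ℕ) {F : Type*} [Field F] (D D' : Set (F → F)) : Prop :=
  ∃ ρ : F ≃+* F, ∃ g h : F → F,
    Function.Bijective g ∧ Function.Bijective h ∧
    (∀ x y : F, g (x + y) = g x + g y) ∧ (∀ l x : F, l ^ q = l → g (l * x) = l * g x) ∧
    (∀ x y : F, h (x + y) = h x + h y) ∧ (∀ l x : F, l ^ q = l → h (l * x) = l * h x) ∧
    D' = {f' | ∃ f ∈ D, f' = g ∘ ⇑ρ ∘ f ∘ ⇑ρ.symm ∘ h}


set_option linter.unusedSimpArgs false

namespace S15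

/-! ### Polynomial identities in characteristic two -/

theorem algA0 {K : Type*} [Field K] [CharP K 2] (X Y Z T U V : K)
    (hn : X * Z * U = 1) (hm : Y * T * V = 1)
    (h1 : U * T^2 * Z * Y * X + U * T * Z * X + T * Y * X + X + T^2 * Z * Y + T * Z * Y
      + T + 1 = 0) :
    (T + 1) * (Z + 1) = (X + 1) * (V + 1) := by
  grind

theorem algA1 {K : Type*} [Field K] [CharP K 2] (r x z u : K) (hr : r ≠ 0) (hr1 : r ≠ 1)
    (hn : (x * r + 1) * (z * r + 1) * (u * r + 1) = 1)
    (hm : (u + 1) * (x + 1) * (z + 1) = 1) :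
    (x*r+1)^2 * (u+1) * (z*r+1)^2 + (x*r+1)^2 * (u+1) * (z*r+1) + (x*r+1)^2*(z*r+1)^2
     + (x*r+1) * (u+1) * (z*r+1)^2 + (x*r+1) * (u+1) * (z*r+1) + 1 = 0 := by
  grind

/-- The norm-one case is impossible. -/
theorem caseA {K : Type*} [Field K] [CharP K 2] (X Y Z T U V : K)
    (hn : X * Z * U = 1) (hm : Y * T * V = 1)
    (hT : T ≠ 1) (hX : X ≠ 1)
    (h1 : (T + 1) * (Z + 1) = (X + 1) * (V + 1))
    (h2 : (U + 1) * (T + 1) = (Y + 1) * (X + 1))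
    (h3 : X * Y * Z + 1 ≠ 0)
    (h5 : X^2 * Y * Z^2 + X^2 * Y * Z + X^2 * Z^2 + X * Y * Z^2 + X * Y * Z + 1 ≠ 0) :
    False := by
  have two : (2 : K) = 0 := CharTwo.two_eq_zero
  have ht : T + 1 ≠ 0 := fun h => hT (by linear_combination h - two)
  have hx : X + 1 ≠ 0 := fun h => hX (by linear_combination h - two)
  have hr : (X + 1) / (T + 1) ≠ 0 := div_ne_zero hx ht
  obtain ⟨r, hrd⟩ : ∃ r, r = (X + 1) / (T + 1) := ⟨_, rfl⟩
  rw [← hrd] at hr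
  have eX : X + 1 = (T + 1) * r := by rw [hrd]; field_simp
  have eZ : Z + 1 = (V + 1) * r := by
    apply mul_left_cancel₀ ht; rw [h1, eX]; ring
  have eU : U + 1 = (Y + 1) * r := by
    apply mul_right_cancel₀ ht; rw [h2, eX]; ring
  have eX' : X = (T + 1) * r + 1 := by linear_combination eX - two
  have eZ' : Z = (V + 1) * r + 1 := by linear_combination eZ - two
  have eU' : U = (Y + 1) * r + 1 := by linear_combination eU - two
  by_cases hr1 : r = 1
  · subst hr1
    apply h3
    have : U = Y := by linear_combination eU
    rw [this] at hn
    linear_combination hn + two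
  · apply h5
    have hY : Y = (Y + 1) + 1 := by linear_combination -two
    have := algA1 r (T + 1) (V + 1) (Y + 1) hr hr1
      (by rw [← eX', ← eZ', ← eU']; exact hn)
      (by
        have hT' : T = (T + 1) + 1 := by linear_combination -two
        have hV' : V = (V + 1) + 1 := by linear_combination -two
        rw [← hY, ← hT', ← hV']; exact hm)
    rw [← eX', ← eZ', ← hY] at this
    exact this

theorem algB0 {K : Type*} [Field K] [CharP K 2] (a b c d : K)
    (h0 : a^2*d + a^2*d^2 + a*b*c*d + a*d + a*d^2 + b*c + b*c^2 + c + c^2 + c^2*d + c*d = 0)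
    (h1 : a^2*b + a^2*b^2 + a*b + a*b^2 + a*b*c*d + a*d + a*d^2 + b^2*c + b^2*c^2 + b*c
      + b*c^2 + b*c^2*d + b*c*d = 0)
    (h2 : a^2*b + a*b + a*b*c*d + a*c*d + a*c*d^2 + b^2*c + b^2*c^2 + b*c^2*d + b*c*d = 0)
    (h3 : a^2*b*d + a*b*c*d + a*b*d + a*c*d + a*c*d^2 + b^2*c + b*c + c*d + c*d^2 = 0)
    (h4 : a^2*b*d + a^2*d + a*b^2*c + a*b*c + a*b*c*d + a*b*d + a*d + b^2*c + b^2*c^2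
      + b*c + b*c^2 = 0)
    (h5 : a*b + a*b^2 + a*b^2*c + a*b*c + a*b*c*d + b + b^2 + b^2*c^2 + b*c^2 + c^2*d
      + c^2*d^2 + c*d + c*d^2 = 0) : a * b * c * d * (a + d) = 0 := by
  have key : a * b * c * d * (a + d) =
      (a*b + b^2*d + b*c + b*d^2 + d^2) *
        (a^2*d + a^2*d^2 + a*b*c*d + a*d + a*d^2 + b*c + b*c^2 + c + c^2 + c^2*d + c*d)
      + (a*d + c*d + d) * (a^2*b + a^2*b^2 + a*b + a*b^2 + a*b*c*d + a*d + a*d^2 + b^2*c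
        + b^2*c^2 + b*c + b*c^2 + b*c^2*d + b*c*d)
      + (a*d + b*d + b*d^2) * (a^2*b + a*b + a*b*c*d + a*c*d + a*c*d^2 + b^2*c + b^2*c^2
        + b*c^2*d + b*c*d)
      + (a + a*b + a*d + b + b*c + c*d + d) * (a^2*b*d + a*b*c*d + a*b*d + a*c*d + a*c*d^2
        + b^2*c + b*c + c*d + c*d^2)
      + (b*c + b*d^2 + c + c*d + d + d^3) * (a^2*b*d + a^2*d + a*b^2*c + a*b*c + a*b*c*d
        + a*b*d + a*d + b^2*c + b^2*c^2 + b*c + b*c^2)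
      + (a*d + b*c) * (a*b + a*b^2 + a*b^2*c + a*b*c + a*b*c*d + b + b^2 + b^2*c^2 + b*c^2
        + c^2*d + c^2*d^2 + c*d + c*d^2) := by
    clear h0 h1 h2 h3 h4 h5
    grind
  rw [key, h0, h1, h2, h3, h4, h5]
  ring

theorem algB {K : Type*} [Field K] [CharP K 2] (a b c d : K)
    (ha : a ≠ 0) (hb : b ≠ 0) (hc : c ≠ 0) (hd : d ≠ 0)
    (hh : 1 + a + a * b + a * c + b + b * c + c ≠ 0)
    (h0 : a^2*d + a^2*d^2 + a*b*c*d + a*d + a*d^2 + b*c + b*c^2 + c + c^2 + c^2*d + c*d = 0)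
    (h1 : a^2*b + a^2*b^2 + a*b + a*b^2 + a*b*c*d + a*d + a*d^2 + b^2*c + b^2*c^2 + b*c
      + b*c^2 + b*c^2*d + b*c*d = 0)
    (h2 : a^2*b + a*b + a*b*c*d + a*c*d + a*c*d^2 + b^2*c + b^2*c^2 + b*c^2*d + b*c*d = 0)
    (h3 : a^2*b*d + a*b*c*d + a*b*d + a*c*d + a*c*d^2 + b^2*c + b*c + c*d + c*d^2 = 0)
    (h4 : a^2*b*d + a^2*d + a*b^2*c + a*b*c + a*b*c*d + a*b*d + a*d + b^2*c + b^2*c^2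
      + b*c + b*c^2 = 0)
    (h5 : a*b + a*b^2 + a*b^2*c + a*b*c + a*b*c*d + b + b^2 + b^2*c^2 + b*c^2 + c^2*d
      + c^2*d^2 + c*d + c*d^2 = 0) : False := by
  have h := algB0 a b c d h0 h1 h2 h3 h4 h5
  have hne : a * b * c * d ≠ 0 := mul_ne_zero (mul_ne_zero (mul_ne_zero ha hb) hc) hd
  have had : a = d := CharTwo.add_eq_zero.mp ((mul_eq_zero.mp h).resolve_left hne)
  subst had
  clear h hne
  grind

/-- `F1` in the coordinates `X = 1 + 1/a`. -/
def P1 {K : Type*} [Field K] (a b c d e : K) : K :=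
  1 + a + a*b + a*b*c + a*b*c*d + a*b*d + a*c + a*c*d^2 + a*d^2 + a*d^2*e + a*d*e + b + b*c
    + b*c*d + b*c*e + b*d + b*d*e + b*e + c + c*d^2 + c*d*e + c*e + d^2 + d^2*e + e

theorem convF1 {K : Type*} [Field K] [CharP K 2] (a b c d e X Y Z T U : K)
    (ha : a * (X + 1) = 1) (hb : b * (Y + 1) = 1) (hc : c * (Z + 1) = 1)
    (hd : d * (T + 1) = 1) (he : e * (U + 1) = 1)
    (h1 : U * T^2 * Z * Y * X + U * T * Z * X + T * Y * X + X + T^2 * Z * Y + T * Z * Y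
      + T + 1 = 0) : P1 a b c d e = 0 := by
  have two : (2 : K) = 0 := CharTwo.two_eq_zero
  have eX : a * X = a + 1 := by linear_combination ha - a * two
  have eY : b * Y = b + 1 := by linear_combination hb - b * two
  have eZ : c * Z = c + 1 := by linear_combination hc - c * two
  have eT : d * T = d + 1 := by linear_combination hd - d * two
  have eU : e * U = e + 1 := by linear_combination he - e * two
  have h : (e*U) * (d*T)^2 * (c*Z) * (b*Y) * (a*X) + (e*U) * (d*T) * d * (c*Z) * (a*X) * b
      + (d*T) * (b*Y) * (a*X) * d * c * e + (a*X) * b * c * d^2 * e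
      + (d*T)^2 * (c*Z) * (b*Y) * a * e + (d*T) * d * (c*Z) * (b*Y) * a * e
      + (d*T) * d * a * b * c * e + a * b * c * d^2 * e = 0 := by
    linear_combination (a * b * c * d^2 * e) * h1
  rw [eX, eY, eZ, eT, eU] at h
  rw [← h, P1]
  clear h eX eY eZ eT eU ha hb hc hd he h1
  grind

/-- The trace case is impossible. -/
theorem caseB {K : Type*} [Field K] [CharP K 2] (X Y Z T U V : K)
    (hn : X + Z + U = X * Z * U) (hm : Y + T + V = Y * T * V)
    (hX : X + 1 ≠ 0) (hY : Y + 1 ≠ 0) (hZ : Z + 1 ≠ 0) (hT : T + 1 ≠ 0) (hU : U + 1 ≠ 0)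
    (hV : V + 1 ≠ 0) (h3 : X * Y * Z + 1 ≠ 0)
    (h10 : U * T^2 * Z * Y * X + U * T * Z * X + T * Y * X + X + T^2 * Z * Y + T * Z * Y
      + T + 1 = 0)
    (h11 : V * U^2 * T * Z * Y + V * U * T * Y + U * Z * Y + Y + U^2 * T * Z + U * T * Z
      + U + 1 = 0)
    (h12 : X * V^2 * U * T * Z + X * V * U * Z + V * T * Z + Z + V^2 * U * T + V * U * T
      + V + 1 = 0)
    (h13 : Y * X^2 * V * U * T + Y * X * V * T + X * U * T + T + X^2 * V * U + X * V * U
      + X + 1 = 0)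
    (h14 : Z * Y^2 * X * V * U + Z * Y * X * U + Y * V * U + U + Y^2 * X * V + Y * X * V
      + Y + 1 = 0)
    (h15 : T * Z^2 * Y * X * V + T * Z * Y * V + Z * X * V + V + Z^2 * Y * X + Z * Y * X
      + Z + 1 = 0) : False := by
  have two : (2 : K) = 0 := CharTwo.two_eq_zero
  obtain ⟨a, ha⟩ : ∃ a, a * (X + 1) = 1 := ⟨_, inv_mul_cancel₀ hX⟩
  obtain ⟨b, hb⟩ : ∃ a, a * (Y + 1) = 1 := ⟨_, inv_mul_cancel₀ hY⟩
  obtain ⟨c, hc⟩ : ∃ a, a * (Z + 1) = 1 := ⟨_, inv_mul_cancel₀ hZ⟩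
  obtain ⟨d, hd⟩ : ∃ a, a * (T + 1) = 1 := ⟨_, inv_mul_cancel₀ hT⟩
  obtain ⟨e, he⟩ : ∃ a, a * (U + 1) = 1 := ⟨_, inv_mul_cancel₀ hU⟩
  obtain ⟨f, hf⟩ : ∃ a, a * (V + 1) = 1 := ⟨_, inv_mul_cancel₀ hV⟩
  have p0 := convF1 a b c d e X Y Z T U ha hb hc hd he h10
  have p1 := convF1 b c d e f Y Z T U V hb hc hd he hf h11
  have p2 := convF1 c d e f a Z T U V X hc hd he hf ha h12
  have p3 := convF1 d e f a b T U V X Y hd he hf ha hb h13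
  have p4 := convF1 e f a b c U V X Y Z he hf ha hb hc h14
  have p5 := convF1 f a b c d V X Y Z T hf ha hb hc hd h15
  clear h10 h11 h12 h13 h14 h15
  have tr : ∀ a c e X Z U : K, a * (X + 1) = 1 → c * (Z + 1) = 1 → e * (U + 1) = 1 →
      X + Z + U = X * Z * U → e = 1 + a + c := by
    clear * - two
    intro a c e X Z U ha hc he h
    grind
  have ee := tr a c e X Z U ha hc he hn
  have ef := tr b d f Y T V hb hd hf hm
  have hh : 1 + a + a * b + a * c + b + b * c + c ≠ 0 := by
    intro h
    apply h3
    clear * - ha hb hc h two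
    grind
  have nz : ∀ a X : K, a * (X + 1) = 1 → a ≠ 0 := by
    rintro a X h rfl
    simp at h
  have na := nz a X ha
  have nb := nz b Y hb
  have nc := nz c Z hc
  have nd := nz d T hd
  clear * - p0 p1 p2 p3 p4 p5 ee ef hh na nb nc nd
  subst ee ef
  apply algB a b c d na nb nc nd hh
  · rw [← p0, P1]; clear * -; grind
  · rw [← p1, P1]; clear * -; grind
  · rw [← p2, P1]; clear * -; grind
  · rw [← p3, P1]; clear * -; grind
  · rw [← p4, P1]; clear * -; grind
  · rw [← p5, P1]; clear * -; grind

end S15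

namespace S15

/-! ### Frobenius and coefficient comparison -/

theorem frob_add {F : Type*} [Field F] [CharP F 2] {e q : ℕ} (hq : q = 2 ^ e) (i : ℕ)
    (x y : F) : (x + y) ^ (q ^ i) = x ^ (q ^ i) + y ^ (q ^ i) := by
  subst hq
  rw [← pow_mul]
  exact add_pow_char_pow x y 2 (e * i)

theorem frob_comp {F : Type*} [Field F] (q i j : ℕ) (x : F) :
    (x ^ (q ^ i)) ^ (q ^ j) = x ^ (q ^ (i + j)) := by
  rw [← pow_mul, ← pow_add]

theorem frob_six {F : Type*} [Field F] [Fintype F] {q : ℕ} (hc : Fintype.card F = q ^ 6)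
    (k : ℕ) (x : F) : x ^ (q ^ (6 + k)) = x ^ (q ^ k) := by
  rw [pow_add, pow_mul, ← hc, FiniteField.pow_card]

theorem coeffs {F : Type*} [Field F] [Fintype F] {q : ℕ} (hq2 : 2 ≤ q)
    (hc : Fintype.card F = q ^ 6) (k : Fin 6 → F)
    (h : ∀ x : F, ∑ i : Fin 6, k i * x ^ (q ^ (i : ℕ)) = 0) : ∀ i, k i = 0 := by
  classical
  let p : Polynomial F := ∑ i : Fin 6, Polynomial.C (k i) * Polynomial.X ^ (q ^ (i : ℕ))
  have hdeg : p.natDegree < Fintype.card F := by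
    refine lt_of_le_of_lt (b := q ^ 5) ?_ ?_
    · apply Polynomial.natDegree_sum_le_of_forall_le
      intro i _
      refine (Polynomial.natDegree_C_mul_X_pow_le _ _).trans ?_
      exact Nat.pow_le_pow_right (by omega) (by omega)
    · rw [hc]
      exact Nat.pow_lt_pow_right (by omega) (by omega)
  have hp : p = 0 := by
    apply Polynomial.eq_zero_of_natDegree_lt_card_of_eval_eq_zero p (f := (id : F → F))
      Function.injective_id _ hdeg
    intro x
    simpa [p, Polynomial.eval_finsetSum] using h x
  intro i
  have hco : p.coeff (q ^ (i : ℕ)) = k i := by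
    simp only [p, Polynomial.finsetSum_coeff, Polynomial.coeff_C_mul, Polynomial.coeff_X_pow]
    rw [Finset.sum_eq_single i]
    · simp
    · intro j _ hj
      have : q ^ (i : ℕ) ≠ q ^ (j : ℕ) := by
        intro hh
        exact hj (Fin.ext (Nat.pow_right_injective hq2 hh).symm)
      simp [this]
    · simp
  rw [← hco, hp, Polynomial.coeff_zero]

theorem coeffs' {F : Type*} [Field F] [Fintype F] {q : ℕ} (hq2 : 2 ≤ q)
    (hc : Fintype.card F = q ^ 6) (k0 k1 k2 k3 k4 k5 : F)
    (h : ∀ x : F, k0 * x + k1 * x ^ (q ^ 1) + k2 * x ^ (q ^ 2) + k3 * x ^ (q ^ 3)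
      + k4 * x ^ (q ^ 4) + k5 * x ^ (q ^ 5) = 0) :
    k0 = 0 ∧ k1 = 0 ∧ k2 = 0 ∧ k3 = 0 ∧ k4 = 0 ∧ k5 = 0 := by
  have := coeffs hq2 hc ![k0, k1, k2, k3, k4, k5] (by
    intro x
    rw [← h x]
    simp [Fin.sum_univ_succ]
    ring)
  exact ⟨this 0, this 1, this 2, this 3, this 4, this 5⟩

/-- The trinomial. -/
def tri (q : ℕ) {F : Type*} [Field F] (c x : F) : F :=
  x ^ (q ^ 1) + x ^ (q ^ 3) + c * x ^ (q ^ 5)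

theorem mem_D {q : ℕ} {F : Type*} [Field F] {c : F} {g : F → F} :
    g ∈ Dcode q c 1 ↔ ∃ a b : F, ∀ x, g x = a * x + b * tri q c x := by
  constructor
  · rintro ⟨a, b, rfl⟩
    exact ⟨a, b, fun x => rfl⟩
  · rintro ⟨a, b, h⟩
    exact ⟨a, b, funext h⟩

theorem reduce {F : Type*} [Field F] [Fintype F] [CharP F 2] {q : ℕ} (hq2 : 2 ≤ q)
    (hc : Fintype.card F = q ^ 6) (c c' : F)
    (hE : CodeEquiv q (Dcode q c 1) (Dcode q c' 1)) :
    ∃ τ : F ≃+* F, ∃ a b a' b' : F, (a ≠ 0 ∨ b ≠ 0) ∧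
      ∀ x, tri q (τ c) (a * x + b * tri q c' x) = a' * x + b' * tri q c' x := by
  obtain ⟨ρ, g, h, hg, hh, gadd, -, -, -, hD⟩ := hE
  obtain ⟨G, hGdef⟩ : ∃ G : F → F, G = g ∘ ⇑ρ := ⟨_, rfl⟩
  obtain ⟨R, hRdef⟩ : ∃ R : F → F, R = ⇑ρ.symm ∘ h := ⟨_, rfl⟩
  have hG : Function.Bijective G := hGdef ▸ hg.comp ρ.bijective
  have hR : Function.Bijective R := hRdef ▸ ρ.symm.bijective.comp hh
  have Gadd : ∀ x y, G (x + y) = G x + G y := by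
    intro x y; simp [hGdef, gadd]
  have mem1 : ∀ f ∈ Dcode q c 1, ∃ a b : F, ∀ x, G (f (R x)) = a * x + b * tri q c' x := by
    intro f hf
    have : (G ∘ f ∘ R) ∈ Dcode q c' 1 := by
      rw [hD]; exact ⟨f, hf, by rw [hGdef, hRdef]; rfl⟩
    exact mem_D.mp this
  have mem2 : ∀ a b : F, ∃ f ∈ Dcode q c 1, ∀ x, a * x + b * tri q c' x = G (f (R x)) := by
    intro a b
    have : (fun x => a * x + b * tri q c' x) ∈ Dcode q c' 1 := mem_D.mpr ⟨a, b, fun _ => rfl⟩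
    rw [hD] at this
    obtain ⟨f, hf, h1⟩ := this
    refine ⟨f, hf, fun x => ?_⟩
    rw [hGdef, hRdef]
    exact congrFun h1 x
  have mem3 : ∀ l : F, ∀ f ∈ Dcode q c 1, ∃ f2 ∈ Dcode q c 1, ∀ y, l * G (f y) = G (f2 y) := by
    intro l f hf
    obtain ⟨a, b, h1⟩ := mem1 f hf
    obtain ⟨f2, hf2, h2⟩ := mem2 (l * a) (l * b)
    refine ⟨f2, hf2, fun y => ?_⟩
    obtain ⟨x, rfl⟩ := hR.2 y
    rw [← h2, h1]; ring
  have lin : ∀ μ : F, (fun x => μ * x) ∈ Dcode q c 1 := fun μ =>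
    mem_D.mpr ⟨μ, 0, fun x => by ring⟩
  have ex : ∀ l : F, ∃ t : F, ∀ y, l * G y = G (t * y) := by
    intro l
    obtain ⟨ψ, hψ, h1⟩ := mem3 l _ (lin 1)
    simp only [one_mul] at h1
    obtain ⟨a, b, hab⟩ := mem_D.mp hψ
    have hb : b = 0 := by
      by_contra hb
      have key : ∀ μ : F, μ ^ (q ^ 1) = μ ^ (q ^ 3) := by
        intro μ
        obtain ⟨f2, hf2, h2⟩ := mem3 l _ (lin μ)
        obtain ⟨a2, b2, hab2⟩ := mem_D.mp hf2
        have h3 : ∀ y, ψ (μ * y) = f2 y := fun y => hG.1 (by rw [← h1, ← h2])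
        have := coeffs' hq2 hc (a * μ - a2) (b * μ ^ (q ^ 1) - b2) 0 (b * μ ^ (q ^ 3) - b2) 0
          (b * c * μ ^ (q ^ 5) - b2 * c) (by
            intro x
            have h4 := h3 x
            rw [hab, hab2] at h4
            simp only [tri, mul_pow] at h4
            linear_combination h4)
        apply mul_left_cancel₀ hb
        linear_combination this.2.1 - this.2.2.2.1
      have := coeffs' hq2 hc (0 : F) 1 0 (-1) 0 0 (by
        intro x
        linear_combination key x)
      exact one_ne_zero this.2.1
    exact ⟨a, fun y => by rw [h1, hab, hb]; ring_nf⟩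
  have G0 : G 0 = 0 := by
    have := Gadd 0 0
    simpa using this
  have hα : G 1 ≠ 0 := fun h0 => one_ne_zero (hG.1 (h0.trans G0.symm))
  have Gmul : ∀ x y, G (x * y) * G 1 = G x * G y := by
    intro x y
    obtain ⟨t, ht⟩ := ex (G x / G 1)
    have h1 := ht 1
    rw [mul_one, div_mul_cancel₀ _ hα] at h1
    have : x = t := hG.1 h1
    subst this
    rw [← ht y]
    field_simp
  let τ0 : F →+* F :=
    { toFun := fun x => G x / G 1
      map_one' := div_self hα
      map_zero' := by simp [G0]
      map_add' := fun x y => by simp [Gadd, add_div]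
      map_mul' := fun x y => by
        have := Gmul x y
        field_simp
        linear_combination this }
  have hτ0 : Function.Bijective τ0 := by
    rw [← Finite.injective_iff_bijective]
    exact τ0.injective
  let τ : F ≃+* F := RingEquiv.ofBijective τ0 hτ0
  have hτ : ∀ x, G x = G 1 * τ x := by
    intro x
    change G x = G 1 * (G x / G 1)
    field_simp
  obtain ⟨a, b, hab⟩ := mem1 _ (lin 1)
  obtain ⟨a', b', hab'⟩ := mem1 (tri q c) (mem_D.mpr ⟨0, 1, fun x => by ring⟩)
  have hH : ∀ x, τ (R x) = (a / G 1) * x + (b / G 1) * tri q c' x := by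
    intro x
    have := hab x
    rw [one_mul, hτ] at this
    field_simp
    linear_combination this
  refine ⟨τ, a / G 1, b / G 1, a' / G 1, b' / G 1, ?_, ?_⟩
  · by_contra hcon
    push Not at hcon
    rw [hcon.1, hcon.2] at hH
    obtain ⟨x, hx⟩ := hR.2 (τ.symm 1)
    have := hH x
    rw [hx] at this
    simp at this
  · intro x
    rw [← hH]
    have h1 : tri q (τ c) (τ (R x)) = τ (tri q c (R x)) := by
      simp [tri]
    rw [h1]
    have := hab' x
    rw [hτ] at this
    field_simp
    linear_combination this

/-- The exceptional equivalences do not occur for parameters in the set. -/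
theorem noB {F : Type*} [Field F] [Fintype F] [CharP F 2] {e q : ℕ} (hq : q = 2 ^ e)
    (hc : Fintype.card F = q ^ 6) (c d b : F) (hcC : c ∈ frakC q F) (hb : b ≠ 0)
    (h2 : b ^ (q ^ 1) + b ^ (q ^ 3) * c ^ (q ^ 3) + d * b ^ (q ^ 5) = 0)
    (h4 : b ^ (q ^ 1) + b ^ (q ^ 3) + d * b ^ (q ^ 5) * c ^ (q ^ 5) = 0) : False := by
  obtain ⟨hne, hF1, -, hF⟩ := hcC
  have hF3 : F3 q c ≠ 0 := fun h => hF (by rw [h]; ring)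
  have hF5 : F5 q c ≠ 0 := fun h => hF (by rw [h]; ring)
  clear hF
  have two : (2 : F) = 0 := CharTwo.two_eq_zero
  let σ : F →+* F := iterateFrobenius F 2 e
  have hσ : ∀ x, σ x = x ^ q := by
    intro x
    simp [σ, iterateFrobenius_def, hq]
  have hs : ∀ (i : ℕ) (x : F), σ (x ^ (q ^ i)) = x ^ (q ^ (i + 1)) := by
    intro i x
    rw [hσ, ← pow_mul, ← pow_succ]
  have h6 : ∀ x : F, x ^ (q ^ 6) = x := fun x => by rw [← hc, FiniteField.pow_card]
  have hc0 : c ≠ 1 := by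
    rintro rfl
    simp at hne
  simp only [F1, F3, F5, pow_add, pow_mul', pow_one] at hF1 hF3 hF5
  have n0 : c + 1 ≠ 0 := fun h => hc0 (by linear_combination h - two)
  have sX : σ c = c ^ (q ^ 1) := by rw [hσ, pow_one]
  have sY := hs 1 c
  have sZ := hs 2 c
  have sT := hs 3 c
  have sU := hs 4 c
  have sV := hs 5 c
  have tb1 := hs 1 b
  have tb2 := hs 2 b
  have tb3 := hs 3 b
  have tb4 := hs 4 b
  have tb5 := hs 5 b
  have tb0 : σ b = b ^ (q ^ 1) := by rw [hσ, pow_one]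
  have b1 : b ^ (q ^ 1) ≠ 0 := pow_ne_zero _ hb
  have b3 : b ^ (q ^ 3) ≠ 0 := pow_ne_zero _ hb
  have b5 : b ^ (q ^ 5) ≠ 0 := pow_ne_zero _ hb
  rw [h6] at sV tb5
  norm_num only at sX sY sZ sT sU sV tb0 tb1 tb2 tb3 tb4 tb5 h2 h4 b1 b3 b5
  have eq1 : c ^ q = c ^ (q ^ 1) := by rw [pow_one]
  simp only [pow_one] at sX sY sZ sT sU sV tb0 tb1 tb2 tb3 tb4 tb5 h2 h4 b1 b3 b5
  clear hs hσ h6 hne eq1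
  generalize c ^ q = Y at *
  generalize c ^ (q ^ 2) = Z at *
  generalize c ^ (q ^ 3) = T at *
  generalize c ^ (q ^ 4) = U at *
  generalize c ^ (q ^ 5) = V at *
  generalize b ^ q = B1 at *
  generalize b ^ (q ^ 2) = B2 at *
  generalize b ^ (q ^ 3) = B3 at *
  generalize b ^ (q ^ 4) = B4 at *
  generalize b ^ (q ^ 5) = B5 at *
  clear_value σ
  have n1 : Y + 1 ≠ 0 := by rw [← sX, ← map_one σ, ← map_add]; exact (map_ne_zero σ).mpr n0
  have n2 : Z + 1 ≠ 0 := by rw [← sY, ← map_one σ, ← map_add]; exact (map_ne_zero σ).mpr n1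
  have n3 : T + 1 ≠ 0 := by rw [← sZ, ← map_one σ, ← map_add]; exact (map_ne_zero σ).mpr n2
  have n4 : U + 1 ≠ 0 := by rw [← sT, ← map_one σ, ← map_add]; exact (map_ne_zero σ).mpr n3
  have n5 : V + 1 ≠ 0 := by rw [← sU, ← map_one σ, ← map_add]; exact (map_ne_zero σ).mpr n4
  have f0 : U * T^2 * Z * Y * c + U * T * Z * c + T * Y * c + c + T^2 * Z * Y + T * Z * Y
      + T + 1 = 0 := by linear_combination hF1
  have f1 := congrArg σ f0
  simp only [map_add, map_mul, map_pow, map_one, map_zero, sX, sY, sZ, sT, sU, sV] at f1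
  have f2 := congrArg σ f1
  simp only [map_add, map_mul, map_pow, map_one, map_zero, sX, sY, sZ, sT, sU, sV] at f2
  have f3 := congrArg σ f2
  simp only [map_add, map_mul, map_pow, map_one, map_zero, sX, sY, sZ, sT, sU, sV] at f3
  have f4 := congrArg σ f3
  simp only [map_add, map_mul, map_pow, map_one, map_zero, sX, sY, sZ, sT, sU, sV] at f4
  have f5 := congrArg σ f4
  simp only [map_add, map_mul, map_pow, map_one, map_zero, sX, sY, sZ, sT, sU, sV] at f5
  -- eliminate `d`
  have g1 : B1 * (V + 1) = B3 * (1 + T * V) := by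
    linear_combination V * h2 - h4 + (B1 - B3 * T * V) * two
  have g2 := congrArg σ (congrArg σ g1)
  simp only [map_add, map_mul, map_one, sX, sY, sZ, sT, sU, sV, tb1, tb2, tb3, tb4, tb5,
    tb0] at g2
  have g3 := congrArg σ (congrArg σ g2)
  simp only [map_add, map_mul, map_one, sX, sY, sZ, sT, sU, sV, tb1, tb2, tb3, tb4, tb5,
    tb0] at g3
  have gp : (V + 1) * (Y + 1) * (T + 1) = (1 + T * V) * (1 + V * Y) * (1 + Y * T) := by
    apply mul_left_cancel₀ (mul_ne_zero (mul_ne_zero b1 b3) b5)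
    calc B1 * B3 * B5 * ((V + 1) * (Y + 1) * (T + 1))
        = (B1 * (V + 1)) * (B3 * (Y + 1)) * (B5 * (T + 1)) := by ring
      _ = _ := by rw [g1, g2, g3]; ring
  have gq : (Y + T + V + Y * T * V) * (1 + Y * T * V) = 0 := by
    linear_combination -gp + (Y + T + V + Y * T * V) * two
  rcases mul_eq_zero.mp gq with h | h
  · have hm : Y + T + V = Y * T * V := by linear_combination h - Y * T * V * two
    have hn := congrArg σ hm
    simp only [map_add, map_mul, sX, sY, sZ, sT, sU, sV] at hn
    exact caseB c Y Z T U V (by linear_combination hn) hm n0 n1 n2 n3 n4 n5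
      (fun h => hF3 (by linear_combination h)) f0 f1 f2 f3 f4 f5
  · have hm : Y * T * V = 1 := by linear_combination h - two
    have hn := congrArg σ hm
    simp only [map_mul, map_one, sX, sY, sZ, sT, sU, sV] at hn
    have hn' : c * Z * U = 1 := by linear_combination hn
    have k1 := algA0 c Y Z T U V hn' hm f0
    have k2 := algA0 Y Z T U V c hm hn f1
    have one : ∀ x : F, x + 1 ≠ 0 → x ≠ 1 := by
      rintro x hx rfl
      exact hx (by linear_combination two)
    exact caseA c Y Z T U V hn' hm (one _ n3) (one _ n0) k1 k2
      (fun h => hF3 (by linear_combination h)) (fun h => hF5 (by linear_combination h))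

theorem key {F : Type*} [Field F] [Fintype F] [CharP F 2] {e q : ℕ} (hq : q = 2 ^ e)
    (hq2 : 2 ≤ q) (hc : Fintype.card F = q ^ 6) (c c' : F) (hcC : c' ∈ frakC q F)
    (hE : CodeEquiv q (Dcode q c 1) (Dcode q c' 1)) : ∃ τ : F ≃+* F, τ c = c' := by
  obtain ⟨τ, a, b, a', b', hne, h⟩ := reduce hq2 hc c c' hE
  refine ⟨τ, ?_⟩
  generalize τ c = d at h ⊢
  obtain ⟨-, k1, k2, k3, k4, k5⟩ := coeffs' hq2 hc
    (b ^ (q ^ 1) * c' ^ (q ^ 1) + b ^ (q ^ 3) + d * b ^ (q ^ 5) - a')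
    (a ^ (q ^ 1) - b')
    (b ^ (q ^ 1) + b ^ (q ^ 3) * c' ^ (q ^ 3) + d * b ^ (q ^ 5))
    (a ^ (q ^ 3) - b')
    (b ^ (q ^ 1) + b ^ (q ^ 3) + d * b ^ (q ^ 5) * c' ^ (q ^ 5))
    (d * a ^ (q ^ 5) - b' * c') (by
      intro x
      have hx := h x
      have e6 : x ^ (q ^ 6) = x := by rw [← hc, FiniteField.pow_card]
      have e8 := frob_six hc 2 x
      have e10 := frob_six hc 4 x
      norm_num only at e8 e10
      simp only [tri, frob_add hq, mul_pow, frob_comp, Nat.reduceAdd, e6, e8, e10] at hx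
      linear_combination hx)
  by_cases ha : a = 0
  · subst ha
    have hb : b ≠ 0 := by simpa using hne
    exact (noB hq hc c' d b hcC hb k2 k4).elim
  · have e13 : a ^ (q ^ 1) = a ^ (q ^ 3) := by linear_combination k1 - k3
    have e35 : a ^ (q ^ 3) = a ^ (q ^ 5) := by
      have := congrArg (fun x => x ^ (q ^ 2)) e13
      simpa only [frob_comp, Nat.reduceAdd] using this
    have : a ^ (q ^ 5) ≠ 0 := pow_ne_zero _ ha
    apply mul_right_cancel₀ this
    linear_combination k5 + c' * e35 - c' * k3

theorem card_aut {F : Type} [Field F] [Fintype F] [CharP F 2] {e : ℕ}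
    (hc : Fintype.card F = (2 ^ e) ^ 6) :
    Finite (F ≃+* F) ∧ Nat.card (F ≃+* F) ≤ 6 * e := by
  letI : Algebra (ZMod 2) F := ZMod.algebra F 2
  haveI : Fact (Nat.Prime 2) := ⟨Nat.prime_two⟩
  have hfr : Module.finrank (ZMod 2) F = 6 * e := by
    have h1 := Module.card_eq_pow_finrank (K := ZMod 2) (V := F)
    rw [hc, ZMod.card, ← pow_mul] at h1
    have := Nat.pow_right_injective (le_refl 2) h1
    omega
  have hcard : Nat.card (F ≃ₐ[ZMod 2] F) = 6 * e := by
    rw [IsGalois.card_aut_eq_finrank, hfr]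
  have hinj : Function.Injective
      (fun τ : F ≃+* F => (AlgEquiv.ofRingEquiv (f := τ) (fun r => by
        exact RingHom.congr_fun (Subsingleton.elim
          ((τ : F →+* F).comp (algebraMap (ZMod 2) F)) (algebraMap (ZMod 2) F)) r) :
          F ≃ₐ[ZMod 2] F)) := by
    intro τ τ' h
    ext x
    exact congrArg (fun f : F ≃ₐ[ZMod 2] F => f x) h
  refine ⟨Finite.of_injective _ hinj, ?_⟩
  rw [← hcard]
  exact Nat.card_le_card_of_injective _ hinj

end S15

theorem statement15 :
    ∃ Q : ℕ, ∀ (e q : ℕ), 1 ≤ e → q = 2 ^ e → Q ≤ q →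
      ∀ (F : Type) [Field F] [Fintype F], Fintype.card F = q ^ 6 →
        ∃ S : Finset (F × ℕ),
          (∀ p ∈ S, p.1 ∈ frakC q F ∧ (p.2 = 1 ∨ p.2 = 5)) ∧
          (∀ p ∈ S, ∀ p' ∈ S, p ≠ p' →
            ¬ CodeEquiv q (Dcode q p.1 p.2) (Dcode q p'.1 p'.2)) ∧
          (frakC q F).ncard ≤ 6 * e * S.card := by
  classical
  refine ⟨0, ?_⟩
  intro e q he hq _ F _ _ hc
  have hq2 : 2 ≤ q := by
    rw [hq]
    calc 2 = 2 ^ 1 := rfl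
      _ ≤ 2 ^ e := Nat.pow_le_pow_right (by norm_num) he
  haveI : Fact (Nat.Prime 2) := ⟨Nat.prime_two⟩
  haveI : CharP F 2 := by
    apply charP_of_card_eq_prime_pow (f := e * 6)
    rw [hc, hq, pow_mul]
  obtain ⟨hfin, hcard⟩ := S15.card_aut (F := F) (e := e) (by rw [hc, hq])
  let r : Setoid (frakC q F) :=
    { r := fun x y => ∃ τ : F ≃+* F, τ x = y
      iseqv :=
        { refl := fun x => ⟨RingEquiv.refl F, rfl⟩
          symm := by
            rintro x y ⟨τ, h⟩
            exact ⟨τ.symm, by rw [← h]; simp⟩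
          trans := by
            rintro x y z ⟨τ, h⟩ ⟨τ', h'⟩
            exact ⟨τ.trans τ', by rw [← h', ← h]; rfl⟩ } }
  haveI : Fintype (Quotient r) := Fintype.ofFinite _
  let rep : Quotient r → F × ℕ := fun Q => ((Q.out : F), 1)
  have hrep : Function.Injective rep := by
    intro Q Q' h
    have h1 : (Q.out : F) = (Q'.out : F) := congrArg Prod.fst h
    have h2 : Q.out = Q'.out := Subtype.ext h1
    rw [← Quotient.out_eq Q, ← Quotient.out_eq Q', h2]
  refine ⟨Finset.univ.image rep, ?_, ?_, ?_⟩
  · intro p hp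
    obtain ⟨Q, -, rfl⟩ := Finset.mem_image.mp hp
    exact ⟨Q.out.2, Or.inl rfl⟩
  · intro p hp p' hp' hne hE
    obtain ⟨Q, -, rfl⟩ := Finset.mem_image.mp hp
    obtain ⟨Q', -, rfl⟩ := Finset.mem_image.mp hp'
    apply hne
    obtain ⟨τ, hτ⟩ := S15.key hq hq2 hc _ _ Q'.out.2 hE
    have h1 : Quotient.mk r Q.out = Quotient.mk r Q'.out := Quotient.sound ⟨τ, hτ⟩
    rw [Quotient.out_eq, Quotient.out_eq] at h1
    rw [h1]
  · rw [Finset.card_image_of_injective _ hrep, Finset.card_univ, ← Nat.card_eq_fintype_card]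
    have hsub : frakC q F ⊆ Set.range
        (fun z : (F ≃+* F) × Quotient r => z.1 (z.2.out : F)) := by
      intro x hx
      have h1 : r.r (Quotient.mk r ⟨x, hx⟩).out ⟨x, hx⟩ := Quotient.mk_out (s := r) ⟨x, hx⟩
      obtain ⟨τ, hτ⟩ := h1
      exact ⟨(τ, Quotient.mk r ⟨x, hx⟩), hτ⟩
    calc (frakC q F).ncard
        ≤ (Set.range (fun z : (F ≃+* F) × Quotient r => z.1 (z.2.out : F))).ncard :=
          Set.ncard_le_ncard hsub (Set.toFinite _)
      _ ≤ Nat.card ((F ≃+* F) × Quotient r) := by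
          rw [← Set.image_univ, ← Set.ncard_univ]
          exact Set.ncard_image_le (Set.toFinite _)
      _ = Nat.card (F ≃+* F) * Nat.card (Quotient r) := Nat.card_prod _ _
      _ ≤ 6 * e * Nat.card (Quotient r) := Nat.mul_le_mul_right _ hcard
end
end

section
/- There exists a constant Q such that for every power of two q = 2^e with q ≥ Q, every finite field F with q^6 elements, every c ∈ 𝔠 and every s ∈ {1,5}, the linear set L_{c,s} = {[(x, x^{q^s} + x^{q^{3s}} + c·x^{q^{5s}})] : x ∈ F, x ≠ 0} ⊆ PG(1,q^6) is not PΓL(2,q^6)-equivalent to any of the following linear sets: L¹ = {[(x, x^q)] : x ≠ 0}; L²_{s',δ} = {[(x, δ·x^{q^{s'}} + x^{q^{6−s'}})] : x ≠ 0} for any s' ∈ {1,5} and any δ ∈ F with δ^{q^5+q^4+q^3+q^2+q+1} ∉ {0,1}; L³_{s',δ} = {[(x, δ·x^{q^{s'}} + x^{q^{s'+3}})] : x ≠ 0} for any s' ∈ {1,2,4,5} and any δ ∈ F with δ^{q^3+1} ∉ {0,1}. Here two point sets L, L' of PG(1,q^6) are PΓL(2,q^6)-equivalent if there exist a field automorphism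 ρ of F and A, B, C, D ∈ F with A·D − B·C ≠ 0 such that the induced map [(x,y)] ↦ [(A·ρ(x) + B·ρ(y), C·ρ(x) + D·ρ(y))] maps L onto L'. -/
noncomputable section

/-- The cone (set of nonzero representative vectors) over the linear set
`L_U ⊆ PG(1,q⁶)` defined by `U = {(x, g x) : x ∈ F}`. -/
def LinSet {F : Type*} [Field F] (g : F → F) : Set (F × F) :=
  {v | ∃ x : F, x ≠ 0 ∧ ∃ l : F, l ≠ 0 ∧ v = (l * x, l * g x)}

/-- `PΓL(2,q⁶)`-equivalence of point sets of `PG(1,q⁶)`, expressed on cones of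
representative vectors. -/
def PGammaLEquiv (F : Type*) [Field F] (L L' : Set (F × F)) : Prop :=
  ∃ ρ : F ≃+* F, ∃ A B C D : F, A * D - B * C ≠ 0 ∧
    {w : F × F | ∃ v ∈ L, w = (A * ρ v.1 + B * ρ v.2, C * ρ v.1 + D * ρ v.2)} = L'

section algebra
variable {F : Type*} [Field F]


lemma relG {c0 c1 c2 c3 c5 : F}
    (h1 : c5 * (c0 * c2 + 1) * (c1 * c2 * c3 + 1) = (c2 + 1) * (c0 * c1 * c2 + 1))
    (h2 : c3 * (c0 * c2 + 1) * (c1 * c2 * c3 + 1) + c3 * (c0 * c1 + c1 * c2) * (c0 * c1 * c2 + 1)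
      + (c0 + 1) * (c0 * c1 * c2 + 1) = 0)
    (ht : c0 * c1 * c2 + 1 ≠ 0) :
    c1 * c3 * c5 * (c0 + c2) + c3 * (c2 + 1) + c5 * (c0 + 1) = 0 := by
  apply mul_left_cancel₀ ht
  linear_combination c5 * h2 - c3 * h1

variable [CharP F 2]

lemma H_ne {c0 c1 c2 c3 c4 c5 : F}
    (g0 : c1 * c3 * c5 * (c0 + c2) + c3 * (c2 + 1) + c5 * (c0 + 1) = 0)
    (g1 : c2 * c4 * c0 * (c1 + c3) + c4 * (c3 + 1) + c0 * (c1 + 1) = 0)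
    (g2 : c3 * c5 * c1 * (c2 + c4) + c5 * (c4 + 1) + c1 * (c2 + 1) = 0)
    (g4 : c5 * c1 * c3 * (c4 + c0) + c1 * (c0 + 1) + c3 * (c4 + 1) = 0)
    (heo : c0 * c2 * c4 = 1 ↔ c1 * c3 * c5 = 1)
    (d0 : c0 ≠ 1) (d1 : c1 ≠ 1)
    (ht : c0 * c1 * c2 + 1 ≠ 0)
    (h5 : c1 * c0 * c2 * (c0 + 1) * (c2 + 1) + (c0 * c2 + 1) ^ 2 ≠ 0) :
    (c0 * c2 * c4 + 1) * (c1 * c3 * c5 + 1) +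
      (c0 * c1 + c1 * c2 + c2 * c3 + c3 * c4 + c4 * c5 + c5 * c0) ≠ 0 := by
  have h2 : (2 : F) = 0 := CharTwo.two_eq_zero
  intro H
  have hs : c0 * c1 + c1 * c2 + c2 * c3 + c3 * c4 + c4 * c5 + c5 * c0 = 0 := by
    linear_combination g0 + g2 + g4 - (c1 * c3 * c5 * (c0 + c2 + c4) + c1 + c3 + c5) * h2
  rw [hs, add_zero] at H
  have heo2 : c0 * c2 * c4 = 1 ∧ c1 * c3 * c5 = 1 := by
    rcases mul_eq_zero.1 H with h | h
    · have := CharTwo.add_eq_zero.1 h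
      exact ⟨this, heo.1 this⟩
    · have := CharTwo.add_eq_zero.1 h
      exact ⟨heo.2 this, this⟩
  obtain ⟨he, ho⟩ := heo2
  have d0' : c0 + 1 ≠ 0 := fun h => d0 (CharTwo.add_eq_zero.1 h)
  have d1' : c1 + 1 ≠ 0 := fun h => d1 (CharTwo.add_eq_zero.1 h)
  have A : (c0 * c2 + 1) * (c3 + 1) = c0 * c2 * (c1 + 1) * (c0 + 1) := by
    have k : (c0 * c2 + 1) * (c3 + 1) + c0 * c2 * (c1 + 1) * (c0 + 1) = 
      c0 * c2 * ((c1 + c3) + c4 * (c3 + 1) + c0 * (c1 + 1)) + (c0 * c2 * c4 + 1) * (c3 + 1) := by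
      clear g0 g1 g2 g4 heo ht h5 hs H he ho d0 d1 d0' d1'
      grind
    have g1' : (c1 + c3) + c4 * (c3 + 1) + c0 * (c1 + 1) = 0 := by
      linear_combination g1 - (c1 + c3) * he
    rw [g1', he, CharTwo.add_self_eq_zero, mul_zero, zero_mul, zero_add] at k
    exact CharTwo.add_eq_zero.1 k
  have B : (c0 * c2 + 1) * (c5 + 1) = c0 * c2 * (c1 + 1) * (c2 + 1) := by
    apply mul_left_cancel₀ d0'
    have g0' : (c2 + 1) * (c3 + 1) = (c0 + 1) * (c5 + 1) := by
      apply CharTwo.add_eq_zero.1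
      linear_combination g0 - (c0 + c2) * ho + h2
    linear_combination (c2 + 1) * A - (c0 * c2 + 1) * g0'
  have E : (c1 + 1) * ((c0 * c1 * c2 + 1) *
      (c1 * c0 * c2 * (c0 + 1) * (c2 + 1) + (c0 * c2 + 1) ^ 2)) = 0 := by
    have a3 : (c0 * c2 + 1) * c3 = c0 * c2 * (c1 + 1) * (c0 + 1) + (c0 * c2 + 1) := by
      linear_combination A - (c0*c2+1) * h2
    have a5 : (c0 * c2 + 1) * c5 = c0 * c2 * (c1 + 1) * (c2 + 1) + (c0 * c2 + 1) := by
      linear_combination B - (c0*c2+1) * h2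
    have : c1 * (c0 * c2 * (c1 + 1) * (c0 + 1) + (c0 * c2 + 1)) *
      (c0 * c2 * (c1 + 1) * (c2 + 1) + (c0 * c2 + 1)) = (c0 * c2 + 1)^2 := by
      rw [← a3, ← a5]; linear_combination (c0 * c2 + 1)^2 * ho
    have k : (c1 + 1) * ((c0 * c1 * c2 + 1) *
      (c1 * c0 * c2 * (c0 + 1) * (c2 + 1) + (c0 * c2 + 1) ^ 2)) =
       c1 * (c0 * c2 * (c1 + 1) * (c0 + 1) + (c0 * c2 + 1)) *
      (c0 * c2 * (c1 + 1) * (c2 + 1) + (c0 * c2 + 1)) + (c0 * c2 + 1)^2 := by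
      clear this a3 a5 A B ho he hs H g0 g1 g2 g4 heo ht h5 d0 d1 d0' d1'
      grind
    rw [k, this, CharTwo.add_self_eq_zero]
  rcases mul_eq_zero.1 E with h | h
  · exact d1' h
  · exact (mul_ne_zero ht h5) h
end algebra
section tens
set_option maxHeartbeats 1000000
variable {F : Type*} [Field F]

/-- six-fold tensors over a two-dimensional space -/
abbrev Ten (F : Type*) := Fin 2 → Fin 2 → Fin 2 → Fin 2 → Fin 2 → Fin 2 → F
abbrev Mt (F : Type*) := Fin 2 → Fin 2 → F

def act0 (m : Mt F) (T : Ten F) : Ten F := fun i j k l r n => m 0 i * T 0 j k l r n + m 1 i * T 1 j k l r n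
def act1 (m : Mt F) (T : Ten F) : Ten F := fun i j k l r n => m 0 j * T i 0 k l r n + m 1 j * T i 1 k l r n
def act2 (m : Mt F) (T : Ten F) : Ten F := fun i j k l r n => m 0 k * T i j 0 l r n + m 1 k * T i j 1 l r n
def act3 (m : Mt F) (T : Ten F) : Ten F := fun i j k l r n => m 0 l * T i j k 0 r n + m 1 l * T i j k 1 r n
def act4 (m : Mt F) (T : Ten F) : Ten F := fun i j k l r n => m 0 r * T i j k l 0 n + m 1 r * T i j k l 1 n
def act5 (m : Mt F) (T : Ten F) : Ten F := fun i j k l r n => m 0 n * T i j k l r 0 + m 1 n * T i j k l r 1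

def dt (m : Mt F) : F := m 0 0 * m 1 1 + m 0 1 * m 1 0

def Hh (T : Ten F) : F := ∑ j, ∑ k, ∑ l, ∑ r, ∑ n,
  T 1 j k l r n * T 0 (1-j) (1-k) (1-l) (1-r) (1-n)

def Cc (p p' : Fin 2) (T : Ten F) : F := ∑ j, ∑ k, ∑ r, ∑ n,
  T 1 j k p r n * T 0 (1-j) (1-k) p' (1-r) (1-n)

lemma C3 (p : Fin 2) (m : Mt F) (T : Ten F) : Cc p p (act3 m T) = m 0 p ^ 2 * Cc 0 0 T +
    m 1 p ^ 2 * Cc 1 1 T + m 0 p * m 1 p * Hh T := by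
  simp only [Cc, act3, Hh, Fin.sum_univ_two, sub_zero, sub_self]
  ring

lemma Hh_smul (l : F) (T : Ten F) : Hh (l • T) = l ^ 2 * Hh T := by
  simp only [Hh, Pi.smul_apply, smul_eq_mul, Finset.mul_sum]
  refine Finset.sum_congr rfl fun _ _ => Finset.sum_congr rfl fun _ _ => Finset.sum_congr rfl fun _ _ =>
    Finset.sum_congr rfl fun _ _ => Finset.sum_congr rfl fun _ _ => by ring

lemma Cc_smul (p p' : Fin 2) (l : F) (T : Ten F) : Cc p p' (l • T) = l ^ 2 * Cc p p' T := by
  simp only [Cc, Pi.smul_apply, smul_eq_mul, Finset.mul_sum]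
  refine Finset.sum_congr rfl fun _ _ => Finset.sum_congr rfl fun _ _ => Finset.sum_congr rfl fun _ _ =>
    Finset.sum_congr rfl fun _ _ => by ring

def actAll (m : Fin 6 → Mt F) (T : Ten F) : Ten F :=
  act1 (m 1) (act2 (m 2) (act4 (m 4) (act5 (m 5) (act0 (m 0) (act3 (m 3) T)))))

def ev (T : Ten F) (w0 w1 w2 w3 w4 w5 : Fin 2 → F) : F := ∑ i, ∑ j, ∑ k, ∑ l, ∑ r, ∑ n,
  T i j k l r n * (w0 i * w1 j * w2 k * w3 l * w4 r * w5 n)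

def mv (m : Mt F) (v : Fin 2 → F) : Fin 2 → F := fun k => m k 0 * v 0 + m k 1 * v 1

lemma ev_act0 (m : Mt F) (T : Ten F) (w0 w1 w2 w3 w4 w5 : Fin 2 → F) :
    ev (act0 m T) w0 w1 w2 w3 w4 w5 = ev T (mv m w0) w1 w2 w3 w4 w5 := by
  simp only [ev, act0, mv, Fin.sum_univ_two]; ring

lemma ev_act1 (m : Mt F) (T : Ten F) (w0 w1 w2 w3 w4 w5 : Fin 2 → F) :
    ev (act1 m T) w0 w1 w2 w3 w4 w5 = ev T w0 (mv m w1) w2 w3 w4 w5 := by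
  simp only [ev, act1, mv, Fin.sum_univ_two]; ring

lemma ev_act2 (m : Mt F) (T : Ten F) (w0 w1 w2 w3 w4 w5 : Fin 2 → F) :
    ev (act2 m T) w0 w1 w2 w3 w4 w5 = ev T w0 w1 (mv m w2) w3 w4 w5 := by
  simp only [ev, act2, mv, Fin.sum_univ_two]; ring

lemma ev_act3 (m : Mt F) (T : Ten F) (w0 w1 w2 w3 w4 w5 : Fin 2 → F) :
    ev (act3 m T) w0 w1 w2 w3 w4 w5 = ev T w0 w1 w2 (mv m w3) w4 w5 := by
  simp only [ev, act3, mv, Fin.sum_univ_two]; ring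

lemma ev_act4 (m : Mt F) (T : Ten F) (w0 w1 w2 w3 w4 w5 : Fin 2 → F) :
    ev (act4 m T) w0 w1 w2 w3 w4 w5 = ev T w0 w1 w2 w3 (mv m w4) w5 := by
  simp only [ev, act4, mv, Fin.sum_univ_two]; ring

lemma ev_act5 (m : Mt F) (T : Ten F) (w0 w1 w2 w3 w4 w5 : Fin 2 → F) :
    ev (act5 m T) w0 w1 w2 w3 w4 w5 = ev T w0 w1 w2 w3 w4 (mv m w5) := by
  simp only [ev, act5, mv, Fin.sum_univ_two]; ring

lemma ev_actAll (m : Fin 6 → Mt F) (T : Ten F) (w0 w1 w2 w3 w4 w5 : Fin 2 → F) :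
    ev (actAll m T) w0 w1 w2 w3 w4 w5 = ev T (mv (m 0) w0) (mv (m 1) w1) (mv (m 2) w2)
      (mv (m 3) w3) (mv (m 4) w4) (mv (m 5) w5) := by
  rw [actAll, ev_act1, ev_act2, ev_act4, ev_act5, ev_act0, ev_act3]

variable [CharP F 2]

lemma H0 (m : Mt F) (T : Ten F) : Hh (act0 m T) = dt m * Hh T := by
  simp only [Hh, act0, dt, Fin.sum_univ_two, sub_zero, sub_self]
  grind
lemma H1 (m : Mt F) (T : Ten F) : Hh (act1 m T) = dt m * Hh T := by
  simp only [Hh, act1, dt, Fin.sum_univ_two, sub_zero, sub_self]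
  grind
lemma H2 (m : Mt F) (T : Ten F) : Hh (act2 m T) = dt m * Hh T := by
  simp only [Hh, act2, dt, Fin.sum_univ_two, sub_zero, sub_self]
  grind
lemma H3 (m : Mt F) (T : Ten F) : Hh (act3 m T) = dt m * Hh T := by
  simp only [Hh, act3, dt, Fin.sum_univ_two, sub_zero, sub_self]
  grind
lemma H4 (m : Mt F) (T : Ten F) : Hh (act4 m T) = dt m * Hh T := by
  simp only [Hh, act4, dt, Fin.sum_univ_two, sub_zero, sub_self]
  grind
lemma H5 (m : Mt F) (T : Ten F) : Hh (act5 m T) = dt m * Hh T := by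
  simp only [Hh, act5, dt, Fin.sum_univ_two, sub_zero, sub_self]
  grind
lemma C0 (p : Fin 2) (m : Mt F) (T : Ten F) : Cc p p (act0 m T) = dt m * Cc p p T := by
  simp only [Cc, act0, dt, Fin.sum_univ_two, sub_zero, sub_self]
  grind
lemma C1 (p : Fin 2) (m : Mt F) (T : Ten F) : Cc p p (act1 m T) = dt m * Cc p p T := by
  simp only [Cc, act1, dt, Fin.sum_univ_two, sub_zero, sub_self]
  grind
lemma C2 (p : Fin 2) (m : Mt F) (T : Ten F) : Cc p p (act2 m T) = dt m * Cc p p T := by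
  simp only [Cc, act2, dt, Fin.sum_univ_two, sub_zero, sub_self]
  grind
lemma C4 (p : Fin 2) (m : Mt F) (T : Ten F) : Cc p p (act4 m T) = dt m * Cc p p T := by
  simp only [Cc, act4, dt, Fin.sum_univ_two, sub_zero, sub_self]
  grind
lemma C5 (p : Fin 2) (m : Mt F) (T : Ten F) : Cc p p (act5 m T) = dt m * Cc p p T := by
  simp only [Cc, act5, dt, Fin.sum_univ_two, sub_zero, sub_self]
  grind
lemma core (Tg Tf : Ten F) (m : Fin 6 → Mt F) (l : F) (hl : l ≠ 0)
    (hm : ∀ i, dt (m i) ≠ 0) (hz : ∀ i k j, m 3 k j = 0 → m i k j = 0)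
    (heq : actAll m Tg = l • Tf)
    (hCg : ∀ p, Cc p p Tg = 0) (hCf : ∀ p, Cc p p Tf = 0) (hH : Hh Tf ≠ 0)
    (hg : Tg 1 0 0 1 0 0 = 0) (hf1 : Tf 1 0 0 1 0 0 ≠ 0) (hf2 : Tf 0 1 1 0 1 1 ≠ 0) : False := by
  have hHg : Hh Tg ≠ 0 := by
    intro h
    have := congrArg Hh heq
    rw [Hh_smul] at this
    simp only [actAll, H0, H1, H2, H3, H4, H5, h, mul_zero] at this
    exact mul_ne_zero (pow_ne_zero 2 hl) hH this.symm
  have hcol : ∀ p, m 3 0 p = 0 ∨ m 3 1 p = 0 := by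
    intro p
    have := congrArg (Cc p p) heq
    rw [Cc_smul, hCf, mul_zero] at this
    simp only [actAll, C0, C1, C2, C3, C4, C5, hCg, mul_zero, zero_add] at this
    simpa [hm, hHg] using this
  have d3 := hm 3
  rcases hcol 0 with h0 | h0 <;> rcases hcol 1 with h1 | h1
  · exact d3 (by simp [dt, h0, h1])
  · have := congrFun (congrFun (congrFun (congrFun (congrFun (congrFun heq 0) 1) 1) 0) 1) 1
    simp only [actAll, act0, act1, act2, act3, act4, act5, hz _ _ _ h0, hz _ _ _ h1, hg,
      Pi.smul_apply, smul_eq_mul, zero_mul, mul_zero, add_zero, zero_add] at this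
    exact mul_ne_zero hl hf2 this.symm
  · have := congrFun (congrFun (congrFun (congrFun (congrFun (congrFun heq 1) 0) 0) 1) 0) 0
    simp only [actAll, act0, act1, act2, act3, act4, act5, hz _ _ _ h0, hz _ _ _ h1, hg,
      Pi.smul_apply, smul_eq_mul, zero_mul, mul_zero, add_zero, zero_add] at this
    exact mul_ne_zero hl hf1 this.symm
  · exact d3 (by simp [dt, h0, h1])

end tens
section detpart
open Matrix
variable {F : Type*} [Field F]
lemma sum_cons {n : ℕ} (f : (Fin (n+1) → Fin 2) → F) :
    ∑ b, f b = ∑ x, ∑ b : Fin n → Fin 2, f (Matrix.vecCons x b) := by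
  rw [← (Fin.consEquiv (fun _ : Fin (n+1) => Fin 2)).sum_comp, Fintype.sum_prod_type]
  rfl

set_option maxHeartbeats 4000000 in
lemma detG [CharP F 2] (c0 c1 c2 c3 c4 c5 x0 x1 x2 x3 x4 x5 y0 y1 y2 y3 y4 y5 : F) :
   det (of ![![y0,x0,0,x0,0,x0*c0],![x1*c1,y1,x1,0,x1,0],![0,x2*c2,y2,x2,0,x2],
     ![x3,0,x3*c3,y3,x3,0],![0,x4,0,x4*c4,y4,x4],![x5,0,x5,0,x5*c5,y5]]) = 
   y0*y1*y2*y3*y4*y5 + c1*x0*x1*y2*y3*y4*y5 + c2*y0*x1*x2*y3*y4*y5 + c3*y0*y1*x2*x3*y4*y5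
   + c4*y0*y1*y2*x3*x4*y5 + c5*y0*y1*y2*y3*x4*x5 + c0*x0*y1*y2*y3*y4*x5
   + x0*y1*y2*x3*y4*y5 + y0*x1*y2*y3*x4*y5 + y0*y1*x2*y3*y4*x5
   + (c2+1)*(c5+1)*y0*x1*x2*y3*x4*x5 + (c3+1)*(c0+1)*x0*y1*x2*x3*y4*x5 + (c4+1)*(c1+1)*x0*x1*y2*x3*x4*y5
   + (1+c4)*(c3*c5+1)*y0*y1*x2*x3*x4*x5 + (1+c5)*(c4*c0+1)*x0*y1*y2*x3*x4*x5
   + (1+c0)*(c5*c1+1)*x0*x1*y2*y3*x4*x5 + (1+c1)*(c0*c2+1)*x0*x1*x2*y3*y4*x5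
   + (1+c2)*(c1*c3+1)*x0*x1*x2*x3*y4*y5 + (1+c3)*(c2*c4+1)*y0*x1*x2*x3*x4*y5
   + (c0*c2*c4+c0+c2+c4)*(c1*c3*c5+c1+c3+c5)*x0*x1*x2*x3*x4*x5 := by
  simp [det_succ_row_zero, Fin.sum_univ_succ, Fin.succAbove]
  grind
end detpart
section setup
open Matrix
variable {F : Type*} [Field F]

/-- rows of the Dickson-type matrix -/
def Rw (σ : Fin 6 → F →+* F) (a : Fin 6 → F) (i : Fin 6) (k : Fin 2) : Fin 6 → F :=
  fun j => if k = 0 then (if i = j then 1 else 0) else σ i (a (j - i))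

def TB (σ : Fin 6 → F →+* F) (a : Fin 6 → F) (b : Fin 6 → Fin 2) : F :=
  det (of fun t => Rw σ a t (b t))

def TT (σ : Fin 6 → F →+* F) (a : Fin 6 → F) : Ten F :=
  fun i j k l r n => TB σ a ![i, j, k, l, r, n]

def MM (σ : Fin 6 → F →+* F) (a : Fin 6 → F) (v : Fin 2 → F) : Matrix (Fin 6) (Fin 6) F :=
  of fun i j => σ i (v 0) * Rw σ a i 0 j + σ i (v 1) * Rw σ a i 1 j

def DD (σ : Fin 6 → F →+* F) (a : Fin 6 → F) (v : Fin 2 → F) : F := det (MM σ a v)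

def ff (σ : Fin 6 → F →+* F) (a : Fin 6 → F) (x : F) : F := ∑ d, a d * σ d x

lemma ev_eq (T : Ten F) (w : Fin 6 → Fin 2 → F) :
    ev T (w 0) (w 1) (w 2) (w 3) (w 4) (w 5) =
      ∑ b : Fin 6 → Fin 2, T (b 0) (b 1) (b 2) (b 3) (b 4) (b 5) * ∏ i, w i (b i) := by
  rw [ev]
  simp only [sum_cons, Fin.prod_univ_six]
  simp

lemma vec6 (b : Fin 6 → Fin 2) : ![b 0, b 1, b 2, b 3, b 4, b 5] = b := by
  funext i; fin_cases i <;> rfl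

lemma det_expand {n : Type*} [Fintype n] [DecidableEq n] (w : n → Fin 2 → F)
    (R : n → Fin 2 → n → F) :
    det (of fun i j => ∑ k, w i k * R i k j) =
      ∑ b : n → Fin 2, det (of fun t => R t (b t)) * ∏ i, w i (b i) := by
  have h1 : (of fun i j => ∑ k, w i k * R i k j) = fun i => ∑ k, w i k • R i k := by
    funext i j
    simp
  have h2 : det (of fun i j => ∑ k, w i k * R i k j) =
      (detRowAlternating (R := F) (n := n)).toMultilinearMap
      (fun i => ∑ k, w i k • R i k) := by
    rw [← h1]; rfl
  rw [h2, MultilinearMap.map_sum]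
  refine Finset.sum_congr rfl fun b _ => ?_
  rw [MultilinearMap.map_smul_univ, smul_eq_mul, mul_comm]
  rfl

lemma DD_eq (σ : Fin 6 → F →+* F) (a : Fin 6 → F) (v : Fin 2 → F) :
    DD σ a v = ∑ b : Fin 6 → Fin 2, TB σ a b * ∏ i, σ i (v (b i)) := by
  have := det_expand (fun i k => σ i (v k)) (fun i k => Rw σ a i k)
  simp only [TB, ← this, DD, MM, Fin.sum_univ_two]

lemma DD_ev (σ : Fin 6 → F →+* F) (a : Fin 6 → F) (v : Fin 2 → F) :
    DD σ a v = ev (TT σ a) (fun k => σ 0 (v k)) (fun k => σ 1 (v k)) (fun k => σ 2 (v k))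
      (fun k => σ 3 (v k)) (fun k => σ 4 (v k)) (fun k => σ 5 (v k)) := by
  have := ev_eq (TT σ a) (fun i k => σ i (v k))
  simp only [TT, vec6] at this
  rw [DD_eq, ← this]

variable (σ : Fin 6 → F →+* F)

lemma MM_mulVec (hadd : ∀ i j x, σ i (σ j x) = σ (i + j) x) (a : Fin 6 → F) (v : Fin 2 → F) (x : F) (i : Fin 6) :
    (MM σ a v *ᵥ fun j => σ j x) i = σ i (v 0 * x + v 1 * ff σ a x) := by
  have e1 : ∑ j, σ i (a (j - i)) * σ j x = σ i (ff σ a x) := by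
    rw [ff, map_sum, ← Equiv.sum_comp (Equiv.addRight i)]
    refine Finset.sum_congr rfl fun j _ => ?_
    simp [map_mul, hadd, add_comm]
  simp only [mulVec, dotProduct, MM, of_apply, Rw, add_mul, Finset.sum_add_distrib, if_true,
    map_add, map_mul, ← e1, Finset.mul_sum]
  simp [mul_assoc]

lemma DD_zero_of (h0 : ∀ x, σ 0 x = x) (hadd : ∀ i j x, σ i (σ j x) = σ (i + j) x) (a : Fin 6 → F) (v : Fin 2 → F) (x : F) (hx : x ≠ 0)
    (h : v 0 * x + v 1 * ff σ a x = 0) : DD σ a v = 0 := by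
  rw [DD, ← exists_mulVec_eq_zero_iff]
  refine ⟨fun j => σ j x, ?_, ?_⟩
  · intro hh
    have := congrFun hh 0
    exact hx (by simpa [h0] using this)
  · funext i
    rw [MM_mulVec σ hadd, h, map_zero]; rfl

lemma of_DD_zero [Finite F] (hadd : ∀ i j x, σ i (σ j x) = σ (i + j) x)
    (hinj : Function.Injective σ) (a : Fin 6 → F) (v : Fin 2 → F) (h : DD σ a v = 0) :
    ∃ x, x ≠ 0 ∧ v 0 * x + v 1 * ff σ a x = 0 := by
  rw [DD, ← exists_vecMul_eq_zero_iff] at h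
  obtain ⟨u, hu, hz⟩ := h
  by_contra! hcon
  let φ : F →+ F :=
    { toFun := fun x => v 0 * x + v 1 * ff σ a x
      map_zero' := by simp [ff]
      map_add' := fun x y => by simp only [ff, map_add, mul_add, Finset.sum_add_distrib]; ring }
  have hφ : Function.Injective φ := by
    rw [injective_iff_map_eq_zero]
    intro x hx
    by_contra hne
    exact hcon x hne hx
  have hsurj := Finite.surjective_of_injective hφ
  have hall : ∀ y, ∑ i, u i * σ i y = 0 := by
    intro y
    obtain ⟨x, rfl⟩ := hsurj y
    have e : (u ᵥ* MM σ a v) ⬝ᵥ (fun j => σ j x) = 0 := by rw [hz]; simp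
    rw [← dotProduct_mulVec] at e
    simp only [dotProduct, MM_mulVec σ hadd] at e
    exact e
  have li := (linearIndependent_monoidHom F F).comp (fun i => ((σ i : F →+* F) : F →* F))
    (fun i j hij => hinj (by
      ext x
      exact DFunLike.congr_fun hij x))
  rw [Fintype.linearIndependent_iff] at li
  apply hu
  funext i
  refine li u ?_ i
  funext y
  simpa using hall y

lemma DD_fixed (hadd : ∀ i j x, σ i (σ j x) = σ (i + j) x) (a : Fin 6 → F) (v : Fin 2 → F) :
    σ 1 (DD σ a v) = DD σ a v := by
  rw [DD, RingHom.map_det, ← det_submatrix_equiv_self (Equiv.addRight (1 : Fin 6)) (MM σ a v)]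
  congr 1
  ext i j
  simp only [RingHom.mapMatrix_apply, map_apply, submatrix_apply, MM, of_apply, Rw, map_add, map_mul,
    Equiv.coe_addRight, hadd, add_comm (1 : Fin 6)]
  congr 2
  · by_cases h : i = j
    · simp [h]
    · simp [h]
  · simp [hadd, add_comm (1 : Fin 6)]
end setup
section polys
open Polynomial
variable {F : Type*} [Field F]

/-- exponent attached to a choice of rows -/
def nb (q : ℕ) (p : Fin 6 ↪ ℕ) (b : Fin 6 → Fin 2) : ℕ :=
  ∑ i ∈ (Finset.univ.filter fun i => b i = 0).map p, q ^ i

lemma nb_inj {q : ℕ} (hq : 2 ≤ q) (p : Fin 6 ↪ ℕ) : Function.Injective (nb q p) := by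
  intro b b' h
  have h1 := Finset.geomSum_injective hq h
  have h2 := Finset.map_injective p h1
  funext i
  have h3 : b i = 0 ↔ b' i = 0 := by simpa using Finset.ext_iff.mp h2 i
  generalize b i = u at *
  generalize b' i = v at *
  clear h h1 h2
  revert u v; decide

lemma nb_le {q : ℕ} (hq : 2 ≤ q) (p : Fin 6 ↪ ℕ) (hp : ∀ i, p i < 6) (b : Fin 6 → Fin 2) :
    (q - 1) * nb q p b < q ^ 6 := by
  have h1 : nb q p b ≤ ∑ i ∈ Finset.range 6, q ^ i := by
    apply Finset.sum_le_sum_of_subset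
    intro j hj
    simp only [Finset.mem_map] at hj
    obtain ⟨i, _, rfl⟩ := hj
    simpa using hp i
  obtain ⟨r, rfl⟩ : ∃ r, q = r + 1 := ⟨q - 1, by omega⟩
  have h2 := Nat.mul_le_mul_left r h1
  have h3 : r * ∑ i ∈ Finset.range 6, (r + 1) ^ i < (r + 1) ^ 6 := by
    have : r * ∑ i ∈ Finset.range 6, (r + 1) ^ i + 1 = (r + 1) ^ 6 := by
      simp only [Finset.sum_range_succ, Finset.sum_range_zero]; ring
    omega
  simpa using lt_of_le_of_lt h2 h3

lemma prod_nb (q : ℕ) (p : Fin 6 ↪ ℕ) (b : Fin 6 → Fin 2) (y : F) :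
    ∏ i, (if b i = 0 then y else 1) ^ (q ^ (p i)) = y ^ nb q p b := by
  rw [nb, Finset.sum_map, ← Finset.prod_pow_eq_pow_sum, Finset.prod_filter]
  refine Finset.prod_congr rfl fun i _ => ?_
  split_ifs <;> simp

lemma prop_of_pow [Fintype F] {q : ℕ} (hq : 2 ≤ q) (hF : Fintype.card F = q ^ 6)
    (p : Fin 6 ↪ ℕ) (hp : ∀ i, p i < 6) (S T : (Fin 6 → Fin 2) → F)
    (h : ∀ y : F, (∑ b, S b * y ^ nb q p b) ^ (q - 1) = (∑ b, T b * y ^ nb q p b) ^ (q - 1)) :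
    ∃ l : F, l ≠ 0 ∧ ∀ b, S b = l * T b := by
  let P : ((Fin 6 → Fin 2) → F) → F[X] := fun S => ∑ b, C (S b) * X ^ nb q p b
  have hc : ∀ S b, (P S).coeff (nb q p b) = S b := by
    intro S b
    simp only [P, finsetSum_coeff, coeff_C_mul, coeff_X_pow, (nb_inj hq p).eq_iff]
    simp
  have hd : ∀ S, ((P S) ^ (q - 1)).natDegree < q ^ 6 := by
    intro S
    obtain ⟨b0, hb0⟩ := Finite.exists_max (nb q p)
    refine lt_of_le_of_lt (natDegree_pow_le) ?_
    refine lt_of_le_of_lt (Nat.mul_le_mul_left _ ?_) (nb_le hq p hp b0)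
    exact natDegree_sum_le_of_forall_le _ _ fun b _ =>
      (natDegree_C_mul_X_pow_le _ _).trans (hb0 b)
  have he : ∀ S y, (P S).eval y = ∑ b, S b * y ^ nb q p b := by
    intro S y
    simp [P, eval_finsetSum]
  have hPP : P S ^ (q - 1) = P T ^ (q - 1) := by
    rw [← sub_eq_zero]
    refine eq_zero_of_natDegree_lt_card_of_eval_eq_zero _ Function.injective_id (fun y => ?_) ?_
    · simp [he, h]
    · rw [hF]
      exact lt_of_le_of_lt (natDegree_sub_le _ _) (max_lt (hd S) (hd T))
  have hq1 : q - 1 ≠ 0 := by omega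
  have d1 : P T ∣ P S := (IsIntegrallyClosed.pow_dvd_pow_iff hq1).mp hPP.symm.dvd
  have d2 : P S ∣ P T := (IsIntegrallyClosed.pow_dvd_pow_iff hq1).mp hPP.dvd
  obtain ⟨u, hu⟩ := associated_of_dvd_dvd d1 d2
  obtain ⟨l, hl, hlu⟩ := Polynomial.isUnit_iff.mp u.isUnit
  refine ⟨l, hl.ne_zero, fun b => ?_⟩
  rw [← hc S b, ← hu, ← hlu, coeff_mul_C, hc, mul_comm]
end polys
section equivs
open Matrix
variable {F : Type*} [Field F]

lemma memLin [Finite F] [CharP F 2] (σ : Fin 6 → F →+* F) (h0 : ∀ x, σ 0 x = x)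
    (hadd : ∀ i j x, σ i (σ j x) = σ (i + j) x) (hinj : Function.Injective σ) (a : Fin 6 → F)
    (X Y : F) : (X, Y) ∈ LinSet (ff σ a) ↔ ((X ≠ 0 ∨ Y ≠ 0) ∧ DD σ a ![Y, X] = 0) := by
  constructor
  · rintro ⟨x, hx, l, hl, hv⟩
    obtain ⟨rfl, rfl⟩ := Prod.mk.inj hv
    refine ⟨Or.inl (mul_ne_zero hl hx), DD_zero_of σ h0 hadd a _ x hx ?_⟩
    have : l * ff σ a x * x + l * x * ff σ a x = 2 * (l * x * ff σ a x) := by ring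
    simp [this, CharTwo.two_eq_zero]
  · rintro ⟨hne, hD⟩
    obtain ⟨x, hx, h⟩ := of_DD_zero σ hadd hinj a _ hD
    simp only [cons_val_zero, cons_val_one] at h
    have h' : Y * x = X * ff σ a x := by
      rw [← CharTwo.sub_eq_add, sub_eq_zero] at h; exact h
    have hX : X ≠ 0 := by
      rintro rfl
      have : Y = 0 := by simpa [hx] using h'
      simp [this] at hne
    refine ⟨x, hx, X / x, div_ne_zero hX hx, ?_⟩
    ext
    · simp [hx]
    · simp only
      field_simp
      exact h'

lemma equiv_iff (σ : Fin 6 → F →+* F) (a a' : Fin 6 → F) (ρ : F ≃+* F)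
    (hρ : ∀ i x, ρ (σ i x) = σ i (ρ x)) (A B C D : F) (hdet : A * D - B * C ≠ 0)
    (h : {w : F × F | ∃ v ∈ LinSet (ff σ a), w = (A * ρ v.1 + B * ρ v.2, C * ρ v.1 + D * ρ v.2)}
      = LinSet (ff σ a')) (X Y : F) :
    (X, Y) ∈ LinSet (ff σ (fun i => ρ (a i))) ↔
      (A * X + B * Y, C * X + D * Y) ∈ LinSet (ff σ a') := by
  have hf : ∀ x, ρ (ff σ a x) = ff σ (fun i => ρ (a i)) (ρ x) := by
    intro x; simp [ff, map_sum, map_mul, hρ]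
  rw [← h]
  constructor
  · rintro ⟨x, hx, l, hl, hv⟩
    obtain ⟨rfl, rfl⟩ := Prod.mk.inj hv
    refine ⟨(ρ.symm l * ρ.symm x, ρ.symm l * ff σ a (ρ.symm x)),
      ⟨ρ.symm x, by simpa using hx, ρ.symm l, by simpa using hl, rfl⟩, ?_⟩
    simp [hf]
  · rintro ⟨⟨x', y'⟩, ⟨x, hx, l, hl, hv⟩, hw⟩
    obtain ⟨rfl, rfl⟩ := Prod.mk.inj hv
    obtain ⟨e1, e2⟩ := Prod.mk.inj hw
    refine ⟨ρ x, by simpa using hx, ρ l, by simpa using hl, ?_⟩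
    simp only [map_mul, hf] at e1 e2
    ext
    · apply mul_left_cancel₀ hdet
      linear_combination D * e1 - B * e2
    · apply mul_left_cancel₀ hdet
      linear_combination A * e2 - C * e1

lemma to_tensor [Fintype F] [CharP F 2] {q : ℕ} (hq : 2 ≤ q) (hF : Fintype.card F = q ^ 6)
    (p : Fin 6 ↪ ℕ) (hp : ∀ i, p i < 6) (σ : Fin 6 → F →+* F)
    (hσ : ∀ i x, σ i x = x ^ (q ^ p i)) (h0 : ∀ x, σ 0 x = x)
    (hadd : ∀ i j x, σ i (σ j x) = σ (i + j) x) (hinj : Function.Injective σ)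
    (hfix : ∀ x, σ 1 x = x → x ^ q = x) (a a' : Fin 6 → F)
    (h : PGammaLEquiv F (LinSet (ff σ a)) (LinSet (ff σ a'))) :
    ∃ ρ : F ≃+* F, ∃ (m : Fin 6 → Mt F) (l : F), l ≠ 0 ∧ (∀ i, dt (m i) ≠ 0) ∧
      (∀ i k j, m 3 k j = 0 → m i k j = 0) ∧
      actAll m (TT σ a') = l • TT σ (fun i => ρ (a i)) := by
  classical
  obtain ⟨ρ, A, B, C, D, hdet, h⟩ := h
  have hρ : ∀ i x, ρ (σ i x) = σ i (ρ x) := by intro i x; simp [hσ]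
  have hiff := equiv_iff σ a a' ρ hρ A B C D hdet h
  let M : Mt F := ![![D, C], ![B, A]]
  let m : Fin 6 → Mt F := fun i k l => σ i (M k l)
  have hpow : ∀ (b : Fin 6 → F) v, (DD σ b v) ^ (q - 1) = if DD σ b v = 0 then 0 else 1 := by
    intro b v
    have h1 := hfix _ (DD_fixed σ hadd b v)
    split_ifs with hz
    · rw [hz, zero_pow]; omega
    · apply mul_left_cancel₀ hz
      rw [← pow_succ', mul_one, Nat.sub_add_cancel (by omega), h1]
  have hev : ∀ (T : Ten F) y, ev T (fun k => σ 0 (![y, 1] k)) (fun k => σ 1 (![y, 1] k))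
      (fun k => σ 2 (![y, 1] k)) (fun k => σ 3 (![y, 1] k)) (fun k => σ 4 (![y, 1] k))
      (fun k => σ 5 (![y, 1] k)) =
      ∑ b : Fin 6 → Fin 2, T (b 0) (b 1) (b 2) (b 3) (b 4) (b 5) * y ^ nb q p b := by
    intro T y
    refine (ev_eq T (fun i k => σ i (![y, 1] k))).trans ?_
    refine Finset.sum_congr rfl fun b _ => ?_
    rw [← prod_nb]
    congr 1
    refine Finset.prod_congr rfl fun i _ => ?_
    rw [hσ]
    congr 1
    generalize b i = u
    fin_cases u <;> simp
  have hmv : ∀ i v, mv (m i) (fun k => σ i (v k)) = fun k => σ i (mv M v k) := by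
    intro i v; funext k; simp [mv, m]
  have key : ∀ y : F, (∑ b : Fin 6 → Fin 2,
      actAll m (TT σ a') (b 0) (b 1) (b 2) (b 3) (b 4) (b 5) * y ^ nb q p b) ^ (q - 1)
      = (∑ b : Fin 6 → Fin 2, TT σ (fun i => ρ (a i)) (b 0) (b 1) (b 2) (b 3) (b 4) (b 5) *
        y ^ nb q p b) ^ (q - 1) := by
    intro y
    rw [← hev, ← hev, ev_actAll]
    simp only [hmv]
    rw [← DD_ev, ← DD_ev, hpow, hpow]
    have e := hiff 1 y
    rw [memLin σ h0 hadd hinj, memLin σ h0 hadd hinj] at e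
    have hv : mv M ![y, 1] = ![C * 1 + D * y, A * 1 + B * y] := by
      funext k; fin_cases k <;> simp [mv, M, add_comm]
    have hne : A * 1 + B * y ≠ 0 ∨ C * 1 + D * y ≠ 0 := by
      by_contra! hcon
      exact hdet (by linear_combination D * hcon.1 - B * hcon.2)
    rw [hv]
    have e' : DD σ (fun i => ρ (a i)) ![y, 1] = 0 ↔
        DD σ a' ![C * 1 + D * y, A * 1 + B * y] = 0 := by
      constructor
      · intro hh; exact (e.mp ⟨Or.inl one_ne_zero, hh⟩).2
      · intro hh; exact (e.mpr ⟨hne, hh⟩).2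
    simp only [e']
  obtain ⟨l, hl, hS⟩ := prop_of_pow hq hF p hp
    (fun b => actAll m (TT σ a') (b 0) (b 1) (b 2) (b 3) (b 4) (b 5))
    (fun b => TT σ (fun i => ρ (a i)) (b 0) (b 1) (b 2) (b 3) (b 4) (b 5)) key
  refine ⟨ρ, m, l, hl, ?_, ?_, ?_⟩
  · intro i
    have : dt (m i) = σ i (A * D - B * C) := by
      simp [dt, m, M, CharTwo.sub_eq_add]; ring
    rw [this]
    exact (map_ne_zero (σ i)).mpr hdet
  · intro i k j
    simp [m]
  · funext i j k l' r n
    have := hS ![i, j, k, l', r, n]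
    simpa using this
end equivs
section sizes
open Matrix
variable {F : Type*} [Field F]

lemma TB_perm (σ : Fin 6 → F →+* F) (a : Fin 6 → F) (b : Fin 6 → Fin 2) (h : TB σ a b ≠ 0) :
    ∃ π : Equiv.Perm (Fin 6), ∀ i, Rw σ a (π i) (b (π i)) i ≠ 0 := by
  rw [TB, det_apply] at h
  obtain ⟨π, _, hπ⟩ := Finset.exists_ne_zero_of_sum_ne_zero h
  refine ⟨π, fun i hi => hπ ?_⟩
  rw [Finset.prod_eq_zero (Finset.mem_univ i), smul_zero]
  exact hi

lemma TB_size (σ : Fin 6 → F →+* F) (a : Fin 6 → F) (k : ℕ) (d : Fin 6)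
    (ha : ∀ i, a i ≠ 0 → k • i = d) (b : Fin 6 → Fin 2) (h : TB σ a b ≠ 0) :
    ∑ i, (if b i = 1 then d else 0) = 0 := by
  obtain ⟨π, hπ⟩ := TB_perm σ a b h
  have e : ∀ i, (if b (π i) = 1 then d else 0) = k • (i - π i) := by
    intro i
    have := hπ i
    simp only [Rw] at this
    rcases Fin.exists_fin_two.mp ⟨b (π i), rfl⟩ with h1 | h1
    · simp only [h1, if_true] at this
      have hi : π i = i := by by_contra hc; simp [hc] at this
      rw [h1, hi]
      simp
    · rw [h1] at this ⊢
      simp only [one_ne_zero, if_false] at this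
      simp only [if_true]
      refine (ha _ fun h0 => this ?_).symm
      rw [h0, map_zero]
  rw [← Equiv.sum_comp π, Finset.sum_congr rfl fun i _ => e i, ← Finset.smul_sum,
    Finset.sum_sub_distrib, Equiv.sum_comp π (fun i => i), sub_self, smul_zero]

lemma size_dec : ∀ d : Fin 6, (d = 2 ∨ d = 3 ∨ d = 4) → ∀ p j k r n : Fin 2,
    ∑ i, (if (![1, j, k, p, r, n] : Fin 6 → Fin 2) i = 1 then d else 0) = 0 →
    ∑ i, (if (![0, 1 - j, 1 - k, p, 1 - r, 1 - n] : Fin 6 → Fin 2) i = 1 then d else 0) ≠ 0 := by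
  simp only [Fin.sum_univ_six]
  decide

lemma Cc_zero (σ : Fin 6 → F →+* F) (a : Fin 6 → F) (k : ℕ) (d : Fin 6)
    (hd : d = 2 ∨ d = 3 ∨ d = 4)
    (ha : ∀ i, a i ≠ 0 → k • i = d) (p : Fin 2) : Cc p p (TT σ a) = 0 := by
  refine Finset.sum_eq_zero fun j _ => Finset.sum_eq_zero fun k _ => Finset.sum_eq_zero fun r _ =>
    Finset.sum_eq_zero fun n _ => ?_
  by_contra hne
  obtain ⟨h1, h2⟩ := mul_ne_zero_iff.mp hne
  exact size_dec d hd p j k r n (TB_size σ a _ d ha _ h1) (TB_size σ a _ d ha _ h2)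

lemma TT_zero (σ : Fin 6 → F →+* F) (a : Fin 6 → F) (h0 : a 0 = 0) (h3 : a 3 = 0) :
    TT σ a 1 0 0 1 0 0 = 0 := by
  by_contra h
  obtain ⟨π, hπ⟩ := TB_perm σ a _ h
  have hf : ∀ i, (![1, 0, 0, 1, 0, 0] : Fin 6 → Fin 2) (π i) = 0 → π i = i := by
    intro i hi
    have := hπ i
    simp only [Rw, hi, if_true] at this
    by_contra hc
    simp [hc] at this
  have hf2 : ∀ t, (![1, 0, 0, 1, 0, 0] : Fin 6 → Fin 2) t = 0 → π t = t := by
    intro t ht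
    have := hf (π.symm t) (by simpa using ht)
    simp only [Equiv.apply_symm_apply] at this
    conv_lhs => rw [this]
    simp
  have g0 : π 0 = 0 ∨ π 0 = 3 := by
    have n1 : π 0 ≠ 1 := fun h => by
      have := π.injective (h.trans (hf2 1 rfl).symm); exact absurd this (by decide)
    have n2 : π 0 ≠ 2 := fun h => by
      have := π.injective (h.trans (hf2 2 rfl).symm); exact absurd this (by decide)
    have n4 : π 0 ≠ 4 := fun h => by
      have := π.injective (h.trans (hf2 4 rfl).symm); exact absurd this (by decide)
    have n5 : π 0 ≠ 5 := fun h => by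
      have := π.injective (h.trans (hf2 5 rfl).symm); exact absurd this (by decide)
    generalize π 0 = u at *
    clear hπ hf hf2
    revert u; decide
  have := hπ 0
  rcases g0 with g | g <;> rw [g] at this
  · simp [Rw, h0] at this
  · have e : (0 - 3 : Fin 6) = 3 := by decide
    simp only [Rw, e, h3, map_zero] at this
    simp at this
end sizes

section fvals
open Matrix
variable {F : Type*} [Field F]

lemma TB_f [CharP F 2] (σ : Fin 6 → F →+* F) (c : F) (b : Fin 6 → Fin 2) (x y : Fin 6 → F)
    (hx : ∀ i, x i = if b i = 0 then 0 else 1) (hy : ∀ i, y i = if b i = 0 then 1 else 0) :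
    TB σ ![0, 1, 0, 1, 0, c] b =
    det (of ![![y 0, x 0, 0, x 0, 0, x 0 * σ 0 c], ![x 1 * σ 1 c, y 1, x 1, 0, x 1, 0],
     ![0, x 2 * σ 2 c, y 2, x 2, 0, x 2],
     ![x 3, 0, x 3 * σ 3 c, y 3, x 3, 0], ![0, x 4, 0, x 4 * σ 4 c, y 4, x 4],
     ![x 5, 0, x 5, 0, x 5 * σ 5 c, y 5]]) := by
  rw [TB]
  congr 1
  ext i j
  simp only [of_apply, Rw, hx, hy]
  by_cases hb : b i = 0
  · simp only [hb, if_true]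
    fin_cases i <;> fin_cases j <;> simp at hb ⊢ <;> simp [hb]
  · simp only [hb, if_false]
    fin_cases i <;> fin_cases j <;> simp at hb ⊢ <;> simp [hb]
end fvals
section fvals2
open Matrix
variable {F : Type*} [Field F] [CharP F 2]

lemma TT_f (σ : Fin 6 → F →+* F) (c : F) (i j k l r n : Fin 2) :
    TT σ ![0, 1, 0, 1, 0, c] i j k l r n = det (of
     ![![if i = 0 then 1 else 0, if i = 0 then 0 else 1, 0, if i = 0 then 0 else 1, 0,
        (if i = 0 then 0 else 1) * σ 0 c],
      ![(if j = 0 then 0 else 1) * σ 1 c, if j = 0 then 1 else 0, if j = 0 then 0 else 1, 0,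
        if j = 0 then 0 else 1, 0],
      ![0, (if k = 0 then 0 else 1) * σ 2 c, if k = 0 then 1 else 0, if k = 0 then 0 else 1, 0,
        if k = 0 then 0 else 1],
      ![if l = 0 then 0 else 1, 0, (if l = 0 then 0 else 1) * σ 3 c, if l = 0 then 1 else 0,
        if l = 0 then 0 else 1, 0],
      ![0, if r = 0 then 0 else 1, 0, (if r = 0 then 0 else 1) * σ 4 c, if r = 0 then 1 else 0,
        if r = 0 then 0 else 1],
      ![if n = 0 then 0 else 1, 0, if n = 0 then 0 else 1, 0, (if n = 0 then 0 else 1) * σ 5 c,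
        if n = 0 then 1 else 0]]) :=
  TB_f σ c ![i, j, k, l, r, n] (fun t => if ![i, j, k, l, r, n] t = 0 then 0 else 1)
    (fun t => if ![i, j, k, l, r, n] t = 0 then 1 else 0) (fun _ => rfl) (fun _ => rfl)

lemma TT_f1 (σ : Fin 6 → F →+* F) (c : F) : TT σ ![0, 1, 0, 1, 0, c] 1 0 0 1 0 0 = 1 := by
  rw [TT_f, detG]; simp

lemma TT_f2 (σ : Fin 6 → F →+* F) (c : F) :
    TT σ ![0, 1, 0, 1, 0, c] 0 1 1 0 1 1 = (σ 2 c + 1) * (σ 5 c + 1) := by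
  rw [TT_f, detG]; simp

set_option maxHeartbeats 2000000 in
lemma Hh_f (σ : Fin 6 → F →+* F) (c : F) : Hh (TT σ ![0, 1, 0, 1, 0, c]) =
    (σ 0 c * σ 2 c * σ 4 c + 1) * (σ 1 c * σ 3 c * σ 5 c + 1) +
    (σ 0 c * σ 1 c + σ 1 c * σ 2 c + σ 2 c * σ 3 c + σ 3 c * σ 4 c + σ 4 c * σ 5 c
      + σ 5 c * σ 0 c) := by
  have key := fun i j k l r n => (TT_f σ c i j k l r n).trans
    (detG _ _ _ _ _ _ _ _ _ _ _ _ _ _ _ _ _ _)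
  simp only [Hh, Fin.sum_univ_two, key, sub_zero, sub_self, if_true, one_ne_zero, if_false,
    mul_zero, zero_mul, mul_one, one_mul, add_zero, zero_add]
  generalize σ 0 c = c0
  generalize σ 1 c = c1
  generalize σ 2 c = c2
  generalize σ 3 c = c3
  generalize σ 4 c = c4
  generalize σ 5 c = c5
  grind
end fvals2
section finale
open Polynomial
variable {F : Type*} [Field F]

lemma F1_map (q : ℕ) (ρ : F ≃+* F) (c : F) : F1 q (ρ c) = ρ (F1 q c) := by
  simp only [F1, map_add, map_pow, map_one]
lemma F2_map (q : ℕ) (ρ : F ≃+* F) (c : F) : F2 q (ρ c) = ρ (F2 q c) := by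
  simp only [F2, map_add, map_pow, map_one]
lemma F3_map (q : ℕ) (ρ : F ≃+* F) (c : F) : F3 q (ρ c) = ρ (F3 q c) := by
  simp only [F3, map_add, map_pow, map_one]
lemma F4_map (q : ℕ) (ρ : F ≃+* F) (c : F) : F4 q (ρ c) = ρ (F4 q c) := by
  simp only [F4, map_add, map_pow]
lemma F5_map (q : ℕ) (ρ : F ≃+* F) (c : F) : F5 q (ρ c) = ρ (F5 q c) := by
  simp only [F5, map_add, map_pow, map_one]

lemma frakC_map (q : ℕ) (ρ : F ≃+* F) (c : F) (h : c ∈ frakC q F) : ρ c ∈ frakC q F := by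
  obtain ⟨h1, h2, h3, h4⟩ := h
  refine ⟨?_, ?_, ?_, ?_⟩
  · rw [← map_pow]; exact fun hh => h1 (ρ.injective hh)
  · rw [F1_map, h2, map_zero]
  · rw [F2_map, h3, map_zero]
  · rw [F3_map, F4_map, F5_map, ← map_mul, ← map_mul]
    exact (map_ne_zero ρ).mpr h4

lemma pow_period [Fintype F] {q : ℕ} (hF : Fintype.card F = q ^ 6) (x : F) (n : ℕ) :
    x ^ (q ^ (n + 6)) = x ^ (q ^ n) := by
  rw [pow_add, mul_comm, pow_mul, ← hF, FiniteField.pow_card]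

lemma pow_mod6 [Fintype F] {q : ℕ} (hF : Fintype.card F = q ^ 6) (x : F) (n : ℕ) :
    x ^ (q ^ n) = x ^ (q ^ (n % 6)) := by
  conv_lhs => rw [← Nat.mod_add_div n 6]
  induction n / 6 with
  | zero => simp
  | succ k ih => rw [mul_add, mul_one, ← add_assoc, pow_period hF, ih]

lemma frakC_facts [Fintype F] [CharP F 2] {e q : ℕ} (hqe : q = 2 ^ e)
    (hF : Fintype.card F = q ^ 6) (c : F) (h : c ∈ frakC q F) :
    c ≠ 1 ∧ (c ^ (q ^ 0) * c ^ (q ^ 2) * c ^ (q ^ 4) + 1) * (c ^ (q ^ 1) * c ^ (q ^ 3) * c ^ (q ^ 5) + 1)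
      + (c ^ (q ^ 0) * c ^ (q ^ 1) + c ^ (q ^ 1) * c ^ (q ^ 2) + c ^ (q ^ 2) * c ^ (q ^ 3)
        + c ^ (q ^ 3) * c ^ (q ^ 4) + c ^ (q ^ 4) * c ^ (q ^ 5) + c ^ (q ^ 5) * c ^ (q ^ 0)) ≠ 0 := by
  obtain ⟨hc, hF1, hF2, hF345⟩ := h
  obtain ⟨hF34, hF5⟩ := mul_ne_zero_iff.mp hF345
  obtain ⟨hF3, -⟩ := mul_ne_zero_iff.mp hF34
  have hc1 : c ≠ 1 := by rintro rfl; simp at hc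
  refine ⟨hc1, ?_⟩
  obtain ⟨τ, hτ⟩ : ∃ τ : F →+* F, ∀ x, τ x = x ^ q :=
    ⟨iterateFrobenius F 2 e, fun x => by rw [iterateFrobenius_def, hqe]⟩
  obtain ⟨cc, hcc⟩ : ∃ cc : ℕ → F, ∀ n, cc n = c ^ (q ^ n) := ⟨_, fun _ => rfl⟩
  have hs : ∀ n, τ (cc n) = cc (n + 1) := by
    intro n; rw [hτ, hcc, hcc, ← pow_mul, pow_succ]
  have hper : ∀ n, cc (n + 6) = cc n := by
    intro n; rw [hcc, hcc, pow_period hF]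
  have E1 : ∀ n, cc n * (cc (n+1) * cc (n+3) + 1) * (cc (n+2) * cc (n+3) * cc (n+4) + 1)
      = (cc (n+3) + 1) * (cc (n+1) * cc (n+2) * cc (n+3) + 1) := by
    intro n
    induction n with
    | zero =>
      have : F1 q c = cc 0 * (cc 1 * cc 3 + 1) * (cc 2 * cc 3 * cc 4 + 1)
        - (cc 3 + 1) * (cc 1 * cc 2 * cc 3 + 1) := by
        simp only [CharTwo.sub_eq_add, hcc, F1, pow_add, pow_one, mul_comm 2, pow_mul, pow_zero]
        ring
      rw [hF1] at this
      exact (sub_eq_zero.mp this.symm)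
    | succ n ih =>
      have := congrArg τ ih
      simp only [map_mul, map_add, map_one, hs] at this
      convert this using 3 <;> ring_nf
  have E2 : ∀ n, cc (n+3) * (cc n * cc (n+2) + 1) * (cc (n+1) * cc (n+2) * cc (n+3) + 1)
      + cc (n+3) * (cc n * cc (n+1) + cc (n+1) * cc (n+2)) * (cc n * cc (n+1) * cc (n+2) + 1)
      + (cc n + 1) * (cc n * cc (n+1) * cc (n+2) + 1) = 0 := by
    intro n
    induction n with
    | zero =>
      rw [← hF2]
      simp only [hcc, F2, pow_add, pow_one, mul_comm 2, pow_mul, pow_zero, zero_add]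
      ring
    | succ n ih =>
      have := congrArg τ ih
      simp only [map_mul, map_add, map_one, hs, map_zero] at this
      convert this using 3 <;> ring_nf
  have ht : ∀ n, cc n * cc (n+1) * cc (n+2) + 1 ≠ 0 := by
    intro n
    induction n with
    | zero =>
      have : F3 q c = cc 0 * cc 1 * cc 2 + 1 := by
        simp only [hcc, F3, pow_add, pow_one, pow_zero]; ring
      rw [this] at hF3
      exact hF3
    | succ n ih =>
      have := (map_ne_zero τ).mpr ih
      simp only [map_mul, map_add, map_one, hs] at this
      convert this using 3
  have G : ∀ n, cc (n+1) * cc (n+3) * cc (n+5) * (cc n + cc (n+2)) + cc (n+3) * (cc (n+2) + 1)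
      + cc (n+5) * (cc n + 1) = 0 := by
    intro n
    refine relG ?_ (E2 n) (ht n)
    have := E1 (n + 5)
    rw [show n + 5 + 1 = n + 6 from rfl, show n + 5 + 2 = (n + 1) + 6 from rfl,
      show n + 5 + 3 = (n + 2) + 6 from rfl, show n + 5 + 4 = (n + 3) + 6 from rfl,
      hper, hper, hper, hper] at this
    exact this
  have p0 : cc 6 = cc 0 := hper 0
  have p1 : cc 7 = cc 1 := hper 1
  have p3 : cc 9 = cc 3 := hper 3
  have cne : ∀ n, cc n ≠ 1 := by
    intro n
    induction n with
    | zero => rw [hcc]; simpa using hc1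
    | succ n ih =>
      intro hh
      apply ih
      apply τ.injective
      rw [hs, hh, map_one]
  have g0 := G 0
  have g1 := G 1
  have g2 := G 2
  have g4 := G 4
  simp only [zero_add, Nat.reduceAdd, p0, p1, p3] at g0 g1 g2 g4
  have hH := H_ne (c0 := cc 0) (c1 := cc 1) (c2 := cc 2) (c3 := cc 3) (c4 := cc 4) (c5 := cc 5)
    g0 g1 g2 g4 ?_ (cne 0) (cne 1) (ht 0) ?_
  · simpa only [hcc] using hH
  · have e1 : τ (cc 0 * cc 2 * cc 4) = cc 1 * cc 3 * cc 5 := by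
      simp only [map_mul, hs, zero_add, Nat.reduceAdd]
    rw [← e1]
    exact (map_eq_one_iff τ τ.injective).symm
  · have : F5 q c = cc 1 * cc 0 * cc 2 * (cc 0 + 1) * (cc 2 + 1) + (cc 0 * cc 2 + 1) ^ 2 := by
      simp only [hcc, F5, pow_add, pow_one, mul_comm 2, pow_mul, pow_zero]
      have h2 := CharTwo.two_eq_zero (R := F)
      ring_nf
      grind
    rw [← this]
    exact hF5
end finale
section last
open Polynomial
variable {F : Type*} [Field F]

lemma noEquiv [Fintype F] {e q : ℕ} (he : 1 ≤ e) (hqe : q = 2 ^ e)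
    (hF : Fintype.card F = q ^ 6) (c : F) (hc : c ∈ frakC q F) (s : ℕ) (hs : s = 1 ∨ s = 5)
    (m n : ℕ) (δ ε : F)
    (hex : ∃ k : Fin 4, ∃ d : Fin 6, (d = 2 ∨ d = 3 ∨ d = 4) ∧
      (∃ i : Fin 6, k.val • i = d ∧ i ≠ 0 ∧ i ≠ 3 ∧ (s * i.val) % 6 = m % 6) ∧
      (∃ j : Fin 6, k.val • j = d ∧ j ≠ 0 ∧ j ≠ 3 ∧ (s * j.val) % 6 = n % 6)) :
    ¬ PGammaLEquiv F
      (LinSet (fun x : F => x ^ (q ^ s) + x ^ (q ^ (3 * s)) + c * x ^ (q ^ (5 * s))))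
      (LinSet (fun x : F => δ * x ^ (q ^ m) + ε * x ^ (q ^ n))) := by
  obtain ⟨k, d, hd, ⟨i, hki, hi0, hi3, him⟩, ⟨j, hkj, hj0, hj3, hjn⟩⟩ := hex
  have hq : 2 ≤ q := by
    rw [hqe]; calc 2 = 2 ^ 1 := rfl
      _ ≤ 2 ^ e := Nat.pow_le_pow_right (by norm_num) he
  have : Fact (Nat.Prime 2) := ⟨Nat.prime_two⟩
  have : CharP F 2 := by
    apply charP_of_card_eq_prime_pow (f := e * 6)
    rw [hF, hqe, pow_mul]
  let p : Fin 6 ↪ ℕ := ⟨fun i => (s * i.val) % 6, by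
    rcases hs with rfl | rfl <;> decide⟩
  have hpdef : ∀ i, p i = (s * i.val) % 6 := fun _ => rfl
  have hp : ∀ i, p i < 6 := fun i => Nat.mod_lt _ (by norm_num)
  let σ : Fin 6 → F →+* F := fun i => iterateFrobenius F 2 (e * p i)
  have hσ : ∀ i x, σ i x = x ^ (q ^ p i) := by
    intro i x
    simp only [σ, iterateFrobenius_def, hqe, pow_mul]
  have h0 : ∀ x, σ 0 x = x := by
    intro x; rw [hσ, hpdef]; simp
  have hadd : ∀ i j x, σ i (σ j x) = σ (i + j) x := by
    intro i j x
    rw [hσ, hσ, hσ, ← pow_mul, ← pow_add, pow_mod6 hF]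
    congr 2
    rw [hpdef, hpdef, hpdef, Fin.val_add, ← Nat.add_mod, Nat.mul_mod s ((i.val + j.val) % 6),
      Nat.mod_mod, ← Nat.mul_mod, mul_add, add_comm]
  have hinj : Function.Injective σ := by
    intro i j hij
    by_contra hne
    have hpn : p i ≠ p j := fun hh => hne (p.injective hh)
    have hqn : q ^ p i ≠ q ^ p j := fun hh => hpn (Nat.pow_right_injective hq hh)
    have hz : (X ^ (q ^ p i) - X ^ (q ^ p j) : F[X]) = 0 := by
      refine eq_zero_of_natDegree_lt_card_of_eval_eq_zero _ Function.injective_id (fun y => ?_) ?_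
      · have := DFunLike.congr_fun hij y
        rw [hσ, hσ] at this
        simp [this]
      · rw [hF]
        refine lt_of_le_of_lt (natDegree_sub_le _ _) ?_
        simp only [natDegree_X_pow]
        exact max_lt (Nat.pow_lt_pow_right (by omega) (hp i)) (Nat.pow_lt_pow_right (by omega) (hp j))
    have h1 := congrArg (fun P => coeff P (q ^ p i)) hz
    simp [coeff_X_pow, hqn] at h1
  have hfix : ∀ x, σ 1 x = x → x ^ q = x := by
    intro x hx
    rw [hσ, hpdef] at hx
    rcases hs with rfl | rfl
    · simpa using hx
    · have hx' : x ^ (q ^ 5) = x := hx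
      have := pow_period hF x 0
      rw [show 0 + 6 = 5 + 1 from rfl, pow_succ, pow_mul, hx'] at this
      simpa using this
  have hσmod : ∀ (i : Fin 6) (t : ℕ), (s * i.val) % 6 = t % 6 → ∀ x, σ i x = x ^ (q ^ t) := by
    intro i t ht x
    rw [hσ, pow_mod6 hF x t, hpdef, ht]
  have ef : (fun x : F => x ^ (q ^ s) + x ^ (q ^ (3 * s)) + c * x ^ (q ^ (5 * s)))
      = ff σ ![0, 1, 0, 1, 0, c] := by
    funext x
    rw [ff, Fin.sum_univ_six, hσmod 1 s (by simp) x, hσmod 3 (3 * s) (by rw [mul_comm]; rfl) x,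
      hσmod 5 (5 * s) (by rw [mul_comm]; rfl) x]
    simp
  let a' : Fin 6 → F := Pi.single i δ + Pi.single j ε
  have eg : (fun x : F => δ * x ^ (q ^ m) + ε * x ^ (q ^ n)) = ff σ a' := by
    funext x
    rw [ff]
    simp only [a', Pi.add_apply, add_mul, Finset.sum_add_distrib, Pi.single_apply, ite_mul, zero_mul,
      Finset.sum_ite_eq', Finset.mem_univ, if_true]
    rw [hσmod i m him x, hσmod j n hjn x]
  rw [ef, eg]
  intro hequiv
  obtain ⟨ρ, M, l, hl, hM, hz, heq⟩ := to_tensor hq hF p hp σ hσ h0 hadd hinj hfix _ _ hequiv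
  have ea : (fun i => ρ ((![0, 1, 0, 1, 0, c] : Fin 6 → F) i)) = ![0, 1, 0, 1, 0, ρ c] := by
    funext i; fin_cases i <;> simp
  rw [ea] at heq
  have hρc := frakC_facts hqe hF (ρ c) (frakC_map q ρ c hc)
  generalize ρ c = c' at heq hρc
  obtain ⟨hc1, hH⟩ := hρc
  have hne : ∀ t, σ t c' + 1 ≠ 0 := by
    intro t ht
    rw [← map_one (σ t), ← map_add, map_eq_zero, ← CharTwo.sub_eq_add, sub_eq_zero] at ht
    exact hc1 ht
  refine core _ _ M l hl hM hz heq (Cc_zero σ a' k.val d hd ?_)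
    (Cc_zero σ _ 3 3 (Or.inr (Or.inl rfl)) ?_) ?_ (TT_zero σ a' ?_ ?_) ?_ ?_
  · intro t ht
    by_cases hti : t = i
    · rw [hti, hki]
    · by_cases htj : t = j
      · rw [htj, hkj]
      · exfalso; apply ht; simp [a', hti, htj]
  · intro t ht
    fin_cases t <;> first | rfl | (exfalso; apply ht; rfl)
  · rw [Hh_f]
    rcases hs with rfl | rfl
    · rw [hσmod 0 0 rfl, hσmod 1 1 rfl, hσmod 2 2 rfl, hσmod 3 3 rfl, hσmod 4 4 rfl, hσmod 5 5 rfl]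
      exact hH
    · rw [hσmod 0 0 rfl, hσmod 1 5 rfl, hσmod 2 4 rfl, hσmod 3 3 rfl, hσmod 4 2 rfl, hσmod 5 1 rfl]
      intro hh
      apply hH
      rw [← hh]
      ring
  · simp [a', hi0.symm, hj0.symm]
  · simp [a', hi3.symm, hj3.symm]
  · rw [TT_f1]; exact one_ne_zero
  · rw [TT_f2]; exact mul_ne_zero (hne 2) (hne 5)
end last

theorem statement16 :
    ∃ Q : ℕ, ∀ (e q : ℕ), 1 ≤ e → q = 2 ^ e → Q ≤ q →
      ∀ (F : Type) [Field F] [Fintype F], Fintype.card F = q ^ 6 →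
        ∀ c ∈ frakC q F, ∀ s ∈ ({1, 5} : Set ℕ),
          let L : Set (F × F) :=
            LinSet (fun x : F => x ^ (q ^ s) + x ^ (q ^ (3 * s)) + c * x ^ (q ^ (5 * s)))
          (¬ PGammaLEquiv F L (LinSet (fun x : F => x ^ q))) ∧
          (∀ s' ∈ ({1, 5} : Set ℕ), ∀ δ : F,
            δ ^ (q ^ 5 + q ^ 4 + q ^ 3 + q ^ 2 + q + 1) ≠ 0 →
            δ ^ (q ^ 5 + q ^ 4 + q ^ 3 + q ^ 2 + q + 1) ≠ 1 →
            ¬ PGammaLEquiv F L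
              (LinSet (fun x : F => δ * x ^ (q ^ s') + x ^ (q ^ (6 - s'))))) ∧
          (∀ s' ∈ ({1, 2, 4, 5} : Set ℕ), ∀ δ : F,
            δ ^ (q ^ 3 + 1) ≠ 0 → δ ^ (q ^ 3 + 1) ≠ 1 →
            ¬ PGammaLEquiv F L
              (LinSet (fun x : F => δ * x ^ (q ^ s') + x ^ (q ^ (s' + 3))))) := by
  refine ⟨0, ?_⟩
  intro e q he hqe _ F _ _ hF c hc s hs
  have hs' : s = 1 ∨ s = 5 := by simpa using hs
  refine ⟨?_, ?_, ?_⟩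
  · have key := noEquiv he hqe hF c hc s hs' 1 1 (1 : F) 0
      (by rcases hs' with rfl | rfl <;> decide)
    simpa using key
  · intro s' hs1 δ _ _
    have hs1' : s' = 1 ∨ s' = 5 := by simpa using hs1
    have key := noEquiv he hqe hF c hc s hs' s' (6 - s') δ 1
      (by rcases hs' with rfl | rfl <;> rcases hs1' with rfl | rfl <;> decide)
    simpa using key
  · intro s' hs1 δ _ _
    have hs1' : s' = 1 ∨ s' = 2 ∨ s' = 4 ∨ s' = 5 := by simpa using hs1
    have key := noEquiv he hqe hF c hc s hs' s' (s' + 3) δ 1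
      (by rcases hs' with rfl | rfl <;> rcases hs1' with rfl | rfl | rfl | rfl <;> decide)
    simpa using key
end
end
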